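/- Let n ≥ 2, let Ω ⊂ ℝⁿ be open, and let A be a Young function; if n ≥ 3 assume that ∫^∞ (t/A(t))^{1/(n−2)} dt < ∞. Then every weakly monotone function u ∈ W^{1,A}_loc(Ω) is locally essentially bounded in Ω, and there exists a constant c = c(n) such that ess osc_{B_r(x)} u ≤ c · r · A_{n−1}^{−1}( ⨍_{B_{2r}(x)} A(|∇u|) dz ) whenever B_{2r}(x) ⊂⊂ Ω, where A_{n−1}^{−1} denotes the generalized right-continuous inverse of A_{n−1} and ⨍ denotes the integral average over the ball. -/

import Mathlib

open MeasureTheory Metric Set Filter ENNReal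
open scoped Topology NNReal

noncomputable section

/-- Euclidean space `ℝⁿ`. -/
abbrev Euc (n : ℕ) : Type := EuclideanSpace ℝ (Fin n)

/-- A Young function: a convex function `A : [0,∞) → [0,∞]` with `A 0 = 0`,
not constant on `(0,∞)`.  (Only values on `[0,∞)` are relevant.) -/
def IsYoung (A : ℝ → ℝ≥0∞) : Prop :=
  A 0 = 0 ∧
    (∀ ⦃x y : ℝ⦄, 0 ≤ x → 0 ≤ y → ∀ ⦃l : ℝ⦄, 0 ≤ l → l ≤ 1 →
      A (l * x + (1 - l) * y) ≤ ENNReal.ofReal l * A x + ENNReal.ofReal (1 - l) * A y) ∧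
    ∃ x y : ℝ, 0 < x ∧ 0 < y ∧ A x ≠ A y

/-- The Young conjugate `Ã(t) = sup { s·t − A(s) : s ≥ 0 }`. -/
def youngConj (A : ℝ → ℝ≥0∞) (t : ℝ) : ℝ≥0∞ :=
  ⨆ s : Ici (0 : ℝ), (ENNReal.ofReal ((s : ℝ) * t) - A s)

/-- The exponent `(n-1)/(n-2)`. -/
def youngExp (n : ℕ) : ℝ := ((n : ℝ) - 1) / ((n : ℝ) - 2)

/-- The Young function `A_{n-1}`; equal to `A` for `n = 2`, and for `n ≥ 3` the
Young conjugate of `t ↦ t^{(n-1)/(n-2)} ∫_t^∞ Ã(r) r^{-1-(n-1)/(n-2)} dr`. -/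
def youngShifted (n : ℕ) (A : ℝ → ℝ≥0∞) : ℝ → ℝ≥0∞ :=
  if n = 2 then A
  else youngConj fun t =>
    ENNReal.ofReal (t ^ youngExp n) *
      ∫⁻ r in Ioi t, youngConj A r / ENNReal.ofReal (r ^ (1 + youngExp n))

/-- The generalized right-continuous inverse of a Young function. -/
def youngInv (A : ℝ → ℝ≥0∞) (τ : ℝ≥0∞) : ℝ≥0∞ :=
  ⨅ (s : ℝ) (_ : 0 ≤ s ∧ τ < A s), ENNReal.ofReal s

/-- The condition `∫^∞ (t/A(t))^{1/(n-2)} dt < ∞`. -/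
def TailCondition (n : ℕ) (A : ℝ → ℝ≥0∞) : Prop :=
  ∃ t₀ : ℝ, 0 < t₀ ∧
    ∫⁻ t in Ioi t₀, (ENNReal.ofReal t / A t) ^ (1 / ((n : ℝ) - 2)) < ∞

/-- The Δ₂-condition near infinity. -/
def Delta2Infty (A : ℝ → ℝ≥0∞) : Prop :=
  ∃ C : ℝ, 2 < C ∧ ∃ t₀ : ℝ, 0 ≤ t₀ ∧ ∀ t : ℝ, t₀ ≤ t → A (2 * t) ≤ ENNReal.ofReal C * A t

/-- `g` is the weak gradient of `u` on the open set `Ω`, with `u` and `g`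
locally integrable on `Ω`. -/
def IsWeakGradOn {n : ℕ} (Ω : Set (Euc n)) (u : Euc n → ℝ) (g : Euc n → Euc n) : Prop :=
  LocallyIntegrableOn u Ω volume ∧ LocallyIntegrableOn (fun x => ‖g x‖) Ω volume ∧
    ∀ φ : Euc n → ℝ, ContDiff ℝ (⊤ : ℕ∞) φ → HasCompactSupport φ → tsupport φ ⊆ Ω →
      ∀ i : Fin n,
        ∫ x, u x * fderiv ℝ φ x (EuclideanSpace.single i 1) = - ∫ x, g x i * φ x

/-- Membership in the Orlicz space `L^A(s)` (finiteness of the Luxemburg norm). -/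
def MemOrliczOn {n : ℕ} (A : ℝ → ℝ≥0∞) (s : Set (Euc n)) (f : Euc n → ℝ) : Prop :=
  ∃ lam : ℝ, 0 < lam ∧ ∫⁻ x in s, A (|f x| / lam) < ∞

/-- `u ∈ W^{1,A}_loc(Ω)`, with weak gradient `g`. -/
def MemW1Aloc {n : ℕ} (A : ℝ → ℝ≥0∞) (Ω : Set (Euc n)) (u : Euc n → ℝ)
    (g : Euc n → Euc n) : Prop :=
  IsWeakGradOn Ω u g ∧
    ∀ Ω' : Set (Euc n), IsOpen Ω' → IsCompact (closure Ω') → closure Ω' ⊆ Ω →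
      MemOrliczOn A Ω' u ∧ MemOrliczOn A Ω' (fun x => ‖g x‖)

/-- `v ∈ W^{1,1}_0(Ω')`: `v` has a weak gradient on `Ω'` and is approximable in the
`W^{1,1}(Ω')` norm by smooth functions compactly supported in `Ω'`. -/
def MemW110 {n : ℕ} (Ω' : Set (Euc n)) (v : Euc n → ℝ) : Prop :=
  ∃ h : Euc n → Euc n, IsWeakGradOn Ω' v h ∧
    ∃ φ : ℕ → Euc n → ℝ,
      (∀ k, ContDiff ℝ (⊤ : ℕ∞) (φ k) ∧ HasCompactSupport (φ k) ∧ tsupport (φ k) ⊆ Ω') ∧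
      Tendsto (fun k => ∫ x in Ω', (|φ k x - v x| + ‖gradient (φ k) x - h x‖))
        atTop (𝓝 0)

/-- `u` is weakly monotone on `Ω`. -/
def WeaklyMonotone {n : ℕ} (Ω : Set (Euc n)) (u : Euc n → ℝ) : Prop :=
  ∀ Ω' : Set (Euc n), IsOpen Ω' → IsCompact (closure Ω') → closure Ω' ⊆ Ω →
    ∀ m M : ℝ, m ≤ M →
      MemW110 Ω' (fun x => max (u x - M) 0 - max (m - u x) 0) →
      ∀ᵐ x ∂volume.restrict Ω', m ≤ u x ∧ u x ≤ M

/-- The essential oscillation of `u` on a set `s`. -/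
def essOsc {n : ℕ} (s : Set (Euc n)) (u : Euc n → ℝ) : ℝ≥0∞ :=
  essSup (fun p : Euc n × Euc n => ENNReal.ofReal |u p.1 - u p.2|)
    ((volume.restrict s).prod (volume.restrict s))

/-- The Riesz-type kernel `1 / (|x-y|ⁿ Ψ(1/|x-y|))`. -/
def rieszKernel {n : ℕ} (Ψ : ℝ → ℝ≥0∞) (x y : Euc n) : ℝ≥0∞ :=
  (ENNReal.ofReal (‖x - y‖ ^ n) * Ψ (1 / ‖x - y‖))⁻¹

/-- The Riesz-type potential `I_Ψ f`. -/
def rieszPot {n : ℕ} (Ψ : ℝ → ℝ≥0∞) (f : Euc n → ℝ≥0∞) (x : Euc n) : ℝ≥0∞ :=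
  ∫⁻ y, f y * rieszKernel Ψ x y

/-- The capacity `C_{Ψ,1}`. -/
def capPsi {n : ℕ} (Ψ : ℝ → ℝ≥0∞) (E : Set (Euc n)) : ℝ≥0∞ :=
  ⨅ (f : Euc n → ℝ≥0∞) (_ : Measurable f) (_ : ∀ x ∈ E, 1 ≤ rieszPot Ψ f x),
    ∫⁻ x, f x


open scoped Convolution in
/-- Mollification of a function by a normed bump function. -/
def mollify {n : ℕ} {E : Type*} [NormedAddCommGroup E] [NormedSpace ℝ E]
    (φ : ContDiffBump (0 : Euc n)) (f : Euc n → E) : Euc n → E :=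
  φ.normed volume ⋆[ContinuousLinearMap.lsmul ℝ ℝ, volume] f

/-- Mollification of an `ℝ≥0∞`-valued function. -/
def lmollify {n : ℕ} (φ : ContDiffBump (0 : Euc n)) (F : Euc n → ℝ≥0∞) (x : Euc n) : ℝ≥0∞ :=
  ∫⁻ y, ENNReal.ofReal (φ.normed volume y) * F (x - y)

section Mollify

variable {n : ℕ} {E : Type*} [NormedAddCommGroup E] [NormedSpace ℝ E]

lemma mollify_apply (φ : ContDiffBump (0 : Euc n)) (f : Euc n → E) (x : Euc n) :
    mollify φ f x = ∫ y, φ.normed volume y • f (x - y) := rfl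

lemma lintegral_normed_eq_one (φ : ContDiffBump (0 : Euc n)) :
    ∫⁻ y, ENNReal.ofReal (φ.normed volume y) = 1 := by
  rw [← ofReal_integral_eq_lintegral_ofReal φ.integrable_normed
    (Eventually.of_forall fun x => φ.nonneg_normed x), φ.integral_normed]
  simp

lemma enorm_mollify_le (φ : ContDiffBump (0 : Euc n)) (f : Euc n → E) (x : Euc n) :
    ‖mollify φ f x‖ₑ ≤ lmollify φ (fun y => ‖f y‖ₑ) x := by
  rw [mollify_apply]
  refine (enorm_integral_le_lintegral_enorm _).trans_eq ?_
  refine lintegral_congr fun y => ?_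
  rw [enorm_smul, Real.enorm_of_nonneg (φ.nonneg_normed y)]

lemma norm_mollify_le (φ : ContDiffBump (0 : Euc n)) (f : Euc n → E) (x : Euc n) :
    ‖mollify φ f x‖ ≤ mollify φ (fun y => ‖f y‖) x := by
  rw [mollify_apply, mollify_apply]
  refine (norm_integral_le_integral_norm _).trans_eq ?_
  refine integral_congr_ae (Eventually.of_forall fun y => ?_)
  simp [norm_smul, abs_of_nonneg (φ.nonneg_normed y)]

lemma measurable_lmollify (φ : ContDiffBump (0 : Euc n)) {F : Euc n → ℝ≥0∞}
    (hF : Measurable F) : Measurable (lmollify φ F) := by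
  unfold lmollify
  refine Measurable.lintegral_prod_right' (f := fun p : Euc n × Euc n =>
    ENNReal.ofReal (φ.normed volume p.2) * F (p.1 - p.2)) ?_
  have := φ.continuous_normed (μ := volume)
  have h := this.measurable
  fun_prop

lemma lintegral_lmollify (φ : ContDiffBump (0 : Euc n)) {F : Euc n → ℝ≥0∞}
    (hF : AEMeasurable F) : ∫⁻ x, lmollify φ F x = ∫⁻ x, F x := by
  unfold lmollify
  have h := (φ.continuous_normed (μ := volume)).measurable
  rw [lintegral_lintegral_swap]
  · have : ∀ y : Euc n, ∫⁻ x, ENNReal.ofReal (φ.normed volume y) * F (x - y) =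
        ENNReal.ofReal (φ.normed volume y) * ∫⁻ x, F x := by
      intro y
      rw [lintegral_const_mul' _ _ ENNReal.ofReal_ne_top, lintegral_sub_right_eq_self]
    simp_rw [this]
    rw [lintegral_mul_const _ (by fun_prop), lintegral_normed_eq_one, one_mul]
  · refine AEMeasurable.mul ?_ ?_
    · exact (h.comp measurable_snd).ennreal_ofReal.aemeasurable
    · exact hF.comp_quasiMeasurePreserving (quasiMeasurePreserving_sub_of_right_invariant _ _)

lemma contDiff_mollify (φ : ContDiffBump (0 : Euc n)) {f : Euc n → E}
    (hf : LocallyIntegrable f) : ContDiff ℝ (⊤ : ℕ∞) (mollify φ f) :=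
  φ.hasCompactSupport_normed.contDiff_convolution_left _ φ.contDiff_normed hf

lemma tendsto_lintegral_mollify_sub [CompleteSpace E] {φ : ℕ → ContDiffBump (0 : Euc n)}
    (hφ : Tendsto (fun i => (φ i).rOut) atTop (𝓝 0))
    (hφ' : ∀ i, (φ i).rOut ≤ 2 * (φ i).rIn) {f : Euc n → E} (hf : Integrable f) :
    Tendsto (fun j => ∫⁻ x, ‖mollify (φ j) f x - f x‖ₑ) atTop (𝓝 0) := by
  set N : ℝ≥0∞ := ∫⁻ x, ‖f x‖ₑ with hN
  have hNfin : N ≠ ∞ := hf.2.ne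
  have hmol : ∀ j, Continuous (mollify (φ j) f) := fun j =>
    (contDiff_mollify (φ j) hf.locallyIntegrable).continuous
  have hmoln : ∀ j, Continuous (mollify (φ j) fun y => ‖f y‖) := fun j =>
    (contDiff_mollify (φ j) hf.norm.locallyIntegrable).continuous
  set a : ℕ → Euc n → ℝ≥0∞ := fun j x => ‖mollify (φ j) f x - f x‖ₑ with ha
  set b : ℕ → Euc n → ℝ≥0∞ := fun j x => ‖mollify (φ j) (fun y => ‖f y‖) x‖ₑ + ‖f x‖ₑ with hb
  have hab : ∀ j x, a j x ≤ b j x := by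
    intro j x
    refine (enorm_sub_le).trans (add_le_add ?_ le_rfl)
    rw [enorm_le_iff_norm_le]
    exact (norm_mollify_le _ _ _).trans (Real.le_norm_self _)
  have ham : ∀ j, AEMeasurable (a j) := fun j =>
    ((hmol j).aestronglyMeasurable.sub hf.1).enorm
  have hbm : ∀ j, AEMeasurable (b j) := fun j =>
    (hmoln j).enorm.measurable.aemeasurable.add hf.1.enorm
  have hbN : ∀ j, ∫⁻ x, b j x ≤ N + N := by
    intro j
    rw [lintegral_add_right' _ hf.1.enorm]
    gcongr
    calc _ ≤ ∫⁻ x, lmollify (φ j) (fun y => ‖f y‖ₑ) x := by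
            refine lintegral_mono fun x => (enorm_mollify_le _ _ _).trans_eq ?_
            simp
      _ = N := lintegral_lmollify _ hf.1.enorm
  have hlim : ∀ᵐ x, Tendsto (fun j => b j x - a j x) atTop (𝓝 (‖f x‖ₑ + ‖f x‖ₑ)) := by
    filter_upwards [ContDiffBump.ae_convolution_tendsto_right_of_locallyIntegrable hφ
      (Eventually.of_forall hφ') hf.locallyIntegrable,
      ContDiffBump.ae_convolution_tendsto_right_of_locallyIntegrable hφ
      (Eventually.of_forall hφ') hf.norm.locallyIntegrable] with x h1 h2
    have h3 : Tendsto (fun j => a j x) atTop (𝓝 0) := by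
      have : Tendsto (fun j => ‖mollify (φ j) f x - f x‖ₑ) atTop (𝓝 ‖f x - f x‖ₑ) :=
        (h1.sub_const _).enorm
      simpa using this
    have h4 : Tendsto (fun j => b j x) atTop (𝓝 (‖f x‖ₑ + ‖f x‖ₑ)) := by
      have : Tendsto (fun j => ‖mollify (φ j) (fun y => ‖f y‖) x‖ₑ) atTop (𝓝 ‖(‖f x‖)‖ₑ) :=
        h2.enorm
      rw [enorm_norm] at this
      exact this.add tendsto_const_nhds
    have := ENNReal.Tendsto.sub h4 h3 (Or.inr (by simp))
    simpa using this
  have hF : N + N ≤ liminf (fun j => (N + N) - ∫⁻ x, a j x) atTop := by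
    calc N + N = ∫⁻ x, liminf (fun j => b j x - a j x) atTop := by
          rw [hN, ← lintegral_add_left' hf.1.enorm]
          refine lintegral_congr_ae ?_
          filter_upwards [hlim] with x hx using hx.liminf_eq.symm
      _ ≤ liminf (fun j => ∫⁻ x, (b j x - a j x)) atTop :=
          lintegral_liminf_le' fun j => (hbm j).sub (ham j)
      _ ≤ _ := by
          refine liminf_le_liminf (Eventually.of_forall fun j => ?_)
          have hfin : ∫⁻ x, a j x ≠ ∞ :=
            (((lintegral_mono (hab j)).trans (hbN j)).trans_lt
              (ENNReal.add_lt_top.2 ⟨hNfin.lt_top, hNfin.lt_top⟩)).ne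
          change ∫⁻ x, (b j x - a j x) ≤ (N + N) - ∫⁻ x, a j x
          rw [lintegral_sub' (ham j) hfin (Eventually.of_forall (hab j))]
          exact tsub_le_tsub_right (hbN j) _
  by_cases hN0 : N + N = 0
  · have : ∀ j, ∫⁻ x, a j x = 0 := fun j =>
      le_antisymm ((lintegral_mono (hab j)).trans ((hbN j).trans hN0.le)) bot_le
    simp only [ha] at this
    simp [this]
  have hfin2 : N + N ≠ ∞ := ENNReal.add_ne_top.2 ⟨hNfin, hNfin⟩
  rw [ENNReal.tendsto_nhds_zero]
  intro ε hε
  by_cases hεN : ε ≤ N + N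
  · have h1 : N + N - ε < liminf (fun j => (N + N) - ∫⁻ x, a j x) atTop :=
      (ENNReal.sub_lt_self hfin2 hN0 hε.ne').trans_le hF
    filter_upwards [eventually_lt_of_lt_liminf h1] with j hj
    by_contra hcon
    push Not at hcon
    exact absurd hj (not_lt.2 (tsub_le_tsub_left hcon.le _))
  · exact Eventually.of_forall fun j =>
      ((lintegral_mono (hab j)).trans (hbN j)).trans (not_le.1 hεN).le

end Mollify

section MollifyGradient

variable {n : ℕ}

lemma gradient_apply (f : Euc n → ℝ) (x : Euc n) (i : Fin n) :
    gradient f x i = fderiv ℝ f x (EuclideanSpace.single i 1) := by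
  have h : inner ℝ (gradient f x) (EuclideanSpace.single i (1 : ℝ)) = gradient f x i := by
    rw [EuclideanSpace.inner_single_right]; simp
  rw [← h, gradient, InnerProductSpace.toDual_symm_apply]

lemma integrable_normed_smul {E : Type*} [NormedAddCommGroup E] [NormedSpace ℝ E]
    (φ : ContDiffBump (0 : Euc n)) {f : Euc n → E} (hf : LocallyIntegrable f) (x : Euc n) :
    Integrable (fun t => φ.normed volume t • f (x - t)) :=
  φ.hasCompactSupport_normed.convolutionExists_left (ContinuousLinearMap.lsmul ℝ ℝ)
    φ.continuous_normed hf x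

lemma fderiv_mollify_apply (φ : ContDiffBump (0 : Euc n)) {f : Euc n → ℝ}
    (hf : LocallyIntegrable f) (x e : Euc n) :
    fderiv ℝ (mollify φ f) x e = ∫ y, f y * fderiv ℝ (φ.normed volume) (x - y) e := by
  have hφ : ContDiff ℝ 1 (φ.normed volume) := φ.contDiff_normed
  have h := (φ.hasCompactSupport_normed (μ := volume)).hasFDerivAt_convolution_left
    (ContinuousLinearMap.lsmul ℝ ℝ) hφ hf x
  have hint := (φ.hasCompactSupport_normed (μ := volume)).fderiv (𝕜 := ℝ)
    |>.convolutionExists_left ((ContinuousLinearMap.lsmul ℝ ℝ).precompL (Euc n))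
      (hφ.continuous_fderiv one_ne_zero) hf x
  have h2 : fderiv ℝ (mollify φ f) x = _ := h.fderiv
  rw [h2, convolution_def, ContinuousLinearMap.integral_apply hint,
    ← integral_sub_left_eq_self _ volume x]
  refine integral_congr_ae (Eventually.of_forall fun y => ?_)
  simp [ContinuousLinearMap.precompL_apply, mul_comm]

lemma gradient_mollify {Ω W : Set (Euc n)} {u : Euc n → ℝ} {g : Euc n → Euc n}
    (hug : IsWeakGradOn Ω u g) (hW : MeasurableSet W) (hWΩ : W ⊆ Ω)
    (hu : IntegrableOn u W) (hg : IntegrableOn g W) (φ : ContDiffBump (0 : Euc n))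
    {x : Euc n} (hx : closedBall x φ.rOut ⊆ W) :
    gradient (mollify φ (W.indicator u)) x = mollify φ (W.indicator g) x := by
  have hu' : Integrable (W.indicator u) := hu.integrable_indicator hW
  have hg' : Integrable (W.indicator g) := hg.integrable_indicator hW
  ext i
  rw [gradient_apply, fderiv_mollify_apply φ hu'.locallyIntegrable]
  set ψ : Euc n → ℝ := fun y => φ.normed volume (x - y) with hψ
  have hψs : ContDiff ℝ (⊤ : ℕ∞) ψ := φ.contDiff_normed.comp (contDiff_const.sub contDiff_id)
  have hsupp : ∀ y, y ∉ closedBall x φ.rOut → x - y ∉ tsupport (φ.normed volume) := by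
    intro y hy hmem
    rw [φ.tsupport_normed_eq] at hmem
    apply hy
    simpa [dist_eq_norm, norm_sub_rev] using hmem
  have hts : tsupport ψ ⊆ closedBall x φ.rOut := by
    refine closure_minimal (fun y hy => ?_) isClosed_closedBall
    by_contra hcon
    exact hy (image_eq_zero_of_notMem_tsupport (f := φ.normed volume) (hsupp y hcon))
  have hcs : HasCompactSupport ψ :=
    HasCompactSupport.of_support_subset_isCompact (isCompact_closedBall x φ.rOut)
      ((subset_tsupport _).trans hts)
  have hfd : ∀ y, fderiv ℝ ψ y (EuclideanSpace.single i 1) =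
      - fderiv ℝ (φ.normed volume) (x - y) (EuclideanSpace.single i 1) := by
    intro y
    have h1 : HasFDerivAt (fun y : Euc n => x - y) (-(ContinuousLinearMap.id ℝ (Euc n))) y := by
      simpa using (hasFDerivAt_id y).const_sub x
    have h2 : DifferentiableAt ℝ (φ.normed volume) (x - y) :=
      (φ.contDiff_normed (n := 1)).differentiable one_ne_zero _
    have h3 := (h2.hasFDerivAt.comp y h1).fderiv
    have h4 : fderiv ℝ ψ y = _ := h3
    rw [h4]; simp
  have key := hug.2.2 ψ hψs hcs (hts.trans (hx.trans hWΩ)) i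
  have e1 : ∫ y, W.indicator u y *
      fderiv ℝ (φ.normed volume) (x - y) (EuclideanSpace.single i 1) =
      - ∫ y, u y * fderiv ℝ ψ y (EuclideanSpace.single i 1) := by
    rw [← integral_neg]
    refine integral_congr_ae (Eventually.of_forall fun y => ?_)
    by_cases hy : y ∈ W
    · simp [hy, hfd]
    · have : x - y ∉ tsupport (fderiv ℝ (φ.normed volume)) := fun h =>
        hsupp y (fun h' => hy (hx h')) (tsupport_fderiv_subset ℝ h)
      simp [hy, hfd, image_eq_zero_of_notMem_tsupport this]
  rw [e1, key, neg_neg]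
  have e2 : mollify φ (W.indicator g) x i =
      ∫ t, φ.normed volume t * (W.indicator g (x - t)) i := by
    rw [mollify_apply]
    have := (EuclideanSpace.proj (𝕜 := ℝ) i : Euc n →L[ℝ] ℝ).integral_comp_comm
      (integrable_normed_smul φ hg'.locallyIntegrable x)
    simpa using this.symm
  rw [e2, ← integral_sub_left_eq_self
    (fun t => φ.normed volume t * (W.indicator g (x - t)).ofLp i) volume x]
  refine integral_congr_ae (Eventually.of_forall fun y => ?_)
  by_cases hy : y ∈ W
  · simp [hy, hψ, mul_comm]
  · have : ψ y = 0 := image_eq_zero_of_notMem_tsupport (f := φ.normed volume)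
      (hsupp y (fun h' => hy (hx h')))
    simp [hy, this]

end MollifyGradient

/-- The open cube with centre `c` and half side `ρ`. -/
def cube {n : ℕ} (c : Euc n) (ρ : ℝ) : Set (Euc n) := {x | ∀ i, |x i - c i| < ρ}

/-- The closed cube with centre `c` and half side `ρ`. -/
def closedCube {n : ℕ} (c : Euc n) (ρ : ℝ) : Set (Euc n) := {x | ∀ i, |x i - c i| ≤ ρ}

section Cube

variable {n : ℕ}

lemma isOpen_cube (c : Euc n) (ρ : ℝ) : IsOpen (cube c ρ) := by
  simp only [cube, ofPred_forall]
  exact isOpen_iInter_of_finite fun i => isOpen_lt (by fun_prop) continuous_const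

lemma isClosed_closedCube (c : Euc n) (ρ : ℝ) : IsClosed (closedCube c ρ) := by
  simp only [closedCube, ofPred_forall]
  exact isClosed_iInter fun i => isClosed_le (by fun_prop) continuous_const

lemma cube_subset_closedCube (c : Euc n) (ρ : ℝ) : cube c ρ ⊆ closedCube c ρ :=
  fun _ hx i => (hx i).le

lemma closedCube_subset_closedCube (c : Euc n) {ρ σ : ℝ} (h : ρ ≤ σ) :
    closedCube c ρ ⊆ closedCube c σ :=
  fun _ hx i => (hx i).trans h

lemma cube_subset_cube (c : Euc n) {ρ σ : ℝ} (h : ρ ≤ σ) : cube c ρ ⊆ cube c σ :=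
  fun _ hx i => (hx i).trans_le h

lemma abs_apply_sub_le_dist (x y : Euc n) (i : Fin n) : |x i - y i| ≤ dist x y := by
  rw [dist_eq_norm]
  simpa using PiLp.norm_apply_le (x - y) i

lemma ball_subset_cube (c : Euc n) (ρ : ℝ) : ball c ρ ⊆ cube c ρ :=
  fun x hx i => (abs_apply_sub_le_dist x c i).trans_lt hx

lemma closedCube_subset_closedBall (c : Euc n) {ρ : ℝ} (hρ : 0 ≤ ρ) :
    closedCube c ρ ⊆ closedBall c (n * ρ) := by
  intro x hx
  rw [mem_closedBall, dist_eq_norm, EuclideanSpace.norm_eq]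
  refine Real.sqrt_le_iff.2 ⟨by positivity, ?_⟩
  calc ∑ i, ‖(x - c) i‖ ^ 2 ≤ ∑ _i : Fin n, ρ ^ 2 := by
        refine Finset.sum_le_sum fun i _ => ?_
        have := hx i
        simp only [PiLp.sub_apply, Real.norm_eq_abs]
        gcongr
    _ = n * ρ ^ 2 := by simp
    _ ≤ (n * ρ) ^ 2 := by
        rw [mul_pow]
        gcongr
        exact_mod_cast Nat.le_self_pow two_ne_zero n

lemma isCompact_closedCube (c : Euc n) (ρ : ℝ) : IsCompact (closedCube c ρ) := by
  rcases le_or_gt 0 ρ with h | h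
  · exact (isCompact_closedBall c (n * ρ)).of_isClosed_subset (isClosed_closedCube c ρ)
      (closedCube_subset_closedBall c h)
  · exact (isCompact_closedBall c (n * (-ρ))).of_isClosed_subset (isClosed_closedCube c ρ)
      ((closedCube_subset_closedCube c (by linarith)).trans
        (closedCube_subset_closedBall c (by linarith)))

lemma closedBall_subset_closedCube {c x : Euc n} {ρ ε : ℝ} (hx : x ∈ closedCube c ρ) :
    closedBall x ε ⊆ closedCube c (ρ + ε) := by
  intro y hy i
  have h1 := abs_apply_sub_le_dist y x i
  have h2 := hx i
  have h3 : dist y x ≤ ε := hy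
  calc |y i - c i| = |(y i - x i) + (x i - c i)| := by ring_nf
    _ ≤ |y i - x i| + |x i - c i| := abs_add_le _ _
    _ ≤ ρ + ε := by linarith

lemma closure_cube_subset (c : Euc n) (ρ : ℝ) : closure (cube c ρ) ⊆ closedCube c ρ :=
  closure_minimal (cube_subset_closedCube c ρ) (isClosed_closedCube c ρ)

end Cube

/-- Smooth approximation of a weakly differentiable function on a cube; the gradients of the
approximants inherit any family of linear-in-`t` bounds satisfied by the weak gradient. -/
lemma exists_smooth_approx {n : ℕ} {Ω : Set (Euc n)} {u : Euc n → ℝ} {g : Euc n → Euc n}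
    (hug : IsWeakGradOn Ω u g) {c : Euc n} {R : ℝ} (hR : 0 < R)
    (hW : closedCube c (2 * R) ⊆ Ω) (hg : IntegrableOn g (closedCube c (2 * R)))
    {F : Euc n → ℝ≥0∞} (hF : Measurable F) {G : ℝ → ℝ≥0∞}
    (hFG : ∀ᵐ z ∂volume.restrict (closedCube c (2 * R)), ∀ t : ℝ, 0 ≤ t →
      ENNReal.ofReal (t * ‖g z‖) ≤ F z + G t) :
    ∃ (v : ℕ → Euc n → ℝ) (Fs : ℕ → Euc n → ℝ≥0∞),
      (∀ j, ContDiff ℝ (⊤ : ℕ∞) (v j)) ∧ (∀ j, Measurable (Fs j)) ∧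
      (∀ j, ∫⁻ x, Fs j x ≤ ∫⁻ x in closedCube c (2 * R), F x) ∧
      (∀ j, ∫⁻ x, ‖v j x‖ₑ ≤ ∫⁻ x in closedCube c (2 * R), ‖u x‖ₑ) ∧
      (∀ j, ∀ x ∈ closedCube c R, ∀ t : ℝ, 0 ≤ t →
        ENNReal.ofReal (t * ‖gradient (v j) x‖) ≤ Fs j x + G t) ∧
      (∀ᵐ x ∂volume.restrict (closedCube c R), Tendsto (fun j => v j x) atTop (𝓝 (u x))) ∧
      Tendsto (fun j => ∫⁻ x in closedCube c R, ‖v j x - u x‖ₑ) atTop (𝓝 0) ∧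
      Tendsto (fun j => ∫⁻ x in closedCube c R, ‖gradient (v j) x - g x‖ₑ) atTop (𝓝 0) := by
  set W := closedCube c (2 * R) with hWdef
  have hWm : MeasurableSet W := (isClosed_closedCube _ _).measurableSet
  have hSm : MeasurableSet (closedCube c R) := (isClosed_closedCube _ _).measurableSet
  have hSW : closedCube c R ⊆ W := closedCube_subset_closedCube c (by linarith)
  have hu : IntegrableOn u W := hug.1.integrableOn_compact_subset hW (isCompact_closedCube _ _)
  have hu' : Integrable (W.indicator u) := hu.integrable_indicator hWm
  have hg' : Integrable (W.indicator g) := hg.integrable_indicator hWm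
  let φ : ℕ → ContDiffBump (0 : Euc n) := fun j =>
    ⟨R / (j + 1) / 2, R / (j + 1), by positivity, half_lt_self (by positivity)⟩
  have hφR : ∀ j, (φ j).rOut ≤ R := fun j =>
    div_le_self hR.le (by linarith [j.cast_nonneg (α := ℝ)])
  have hφ0 : Tendsto (fun j => (φ j).rOut) atTop (𝓝 0) :=
    tendsto_const_nhds.div_atTop (tendsto_atTop_add_const_right _ _ tendsto_natCast_atTop_atTop)
  have hφ2 : ∀ j, (φ j).rOut ≤ 2 * (φ j).rIn := fun j => by
    change R / (j + 1) ≤ 2 * (R / (j + 1) / 2)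
    linarith
  have hball : ∀ j, ∀ x ∈ closedCube c R, closedBall x (φ j).rOut ⊆ W := fun j x hx =>
    (closedBall_subset_closedCube hx).trans
      (closedCube_subset_closedCube c (by linarith [hφR j]))
  have hgrad : ∀ j, ∀ x ∈ closedCube c R,
      gradient (mollify (φ j) (W.indicator u)) x = mollify (φ j) (W.indicator g) x :=
    fun j x hx => gradient_mollify hug hWm hW hu hg (φ j) (hball j x hx)
  refine ⟨fun j => mollify (φ j) (W.indicator u), fun j => lmollify (φ j) (W.indicator F),
    fun j => contDiff_mollify _ hu'.locallyIntegrable,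
    fun j => measurable_lmollify _ (hF.indicator hWm), fun j => ?_, fun j => ?_, ?_, ?_, ?_, ?_⟩
  · rw [lintegral_lmollify _ (hF.indicator hWm).aemeasurable, lintegral_indicator hWm]
  · calc _ ≤ ∫⁻ x, lmollify (φ j) (fun y => ‖W.indicator u y‖ₑ) x :=
          lintegral_mono fun x => enorm_mollify_le _ _ _
      _ = ∫⁻ x, ‖W.indicator u x‖ₑ := lintegral_lmollify _ hu'.1.enorm
      _ = ∫⁻ x, W.indicator (fun x => ‖u x‖ₑ) x := by simp_rw [enorm_indicator_eq_indicator_enorm]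
      _ = _ := lintegral_indicator hWm _
      _ ≤ _ := le_rfl
  · intro j x hx t ht
    rw [hgrad j x hx]
    have hFG' : ∀ᵐ y, x - y ∈ W → ∀ t : ℝ, 0 ≤ t →
        ENNReal.ofReal (t * ‖g (x - y)‖) ≤ F (x - y) + G t := by
      have h1 := (ae_restrict_iff' hWm).1 hFG
      exact (quasiMeasurePreserving_sub_left_of_right_invariant volume x).ae h1
    have hη := ((φ j).continuous_normed (μ := volume)).measurable
    calc ENNReal.ofReal (t * ‖mollify (φ j) (W.indicator g) x‖)
        = ENNReal.ofReal t * ‖mollify (φ j) (W.indicator g) x‖ₑ := by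
          rw [ENNReal.ofReal_mul ht, ofReal_norm]
      _ ≤ ENNReal.ofReal t * lmollify (φ j) (fun y => ‖W.indicator g y‖ₑ) x := by
          gcongr; exact enorm_mollify_le _ _ _
      _ = ∫⁻ y, ENNReal.ofReal ((φ j).normed volume y) *
            (ENNReal.ofReal t * ‖W.indicator g (x - y)‖ₑ) := by
          rw [lmollify, ← lintegral_const_mul' _ _ ENNReal.ofReal_ne_top]
          refine lintegral_congr fun y => ?_
          ring
      _ ≤ ∫⁻ y, (ENNReal.ofReal ((φ j).normed volume y) * W.indicator F (x - y) +
            ENNReal.ofReal ((φ j).normed volume y) * G t) := by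
          refine lintegral_mono_ae ?_
          filter_upwards [hFG'] with y hy
          rw [← mul_add]
          by_cases hxy : x - y ∈ W
          · gcongr
            simp only [indicator_of_mem hxy]
            rw [← ofReal_norm, ← ENNReal.ofReal_mul ht]
            exact hy hxy t ht
          · simp [hxy]
      _ = lmollify (φ j) (W.indicator F) x + G t := by
          rw [lintegral_add_right _ (by fun_prop), lintegral_mul_const _ (by fun_prop),
            lintegral_normed_eq_one, one_mul, lmollify]
  · have h := ContDiffBump.ae_convolution_tendsto_right_of_locallyIntegrable hφ0
      (Eventually.of_forall hφ2) hu'.locallyIntegrable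
    rw [ae_restrict_iff' hSm]
    filter_upwards [h] with x hx hxS
    rw [indicator_of_mem (hSW hxS)] at hx
    exact hx
  · refine tendsto_of_tendsto_of_tendsto_of_le_of_le tendsto_const_nhds
      (tendsto_lintegral_mollify_sub hφ0 hφ2 hu') (fun _ => bot_le) fun j => ?_
    refine le_trans (le_of_eq ?_) (setLIntegral_le_lintegral (closedCube c R) _)
    refine setLIntegral_congr_fun hSm fun x hx => ?_
    simp [indicator_of_mem (hSW hx)]
  · refine tendsto_of_tendsto_of_tendsto_of_le_of_le tendsto_const_nhds
      (tendsto_lintegral_mollify_sub hφ0 hφ2 hg') (fun _ => bot_le) fun j => ?_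
    refine le_trans (le_of_eq ?_) (setLIntegral_le_lintegral (closedCube c R) _)
    refine setLIntegral_congr_fun hSm fun x hx => ?_
    simp [indicator_of_mem (hSW hx), hgrad j x hx]

section Potential

lemma lintegral_comp_homothety {m : ℕ} (a b : Fin m → ℝ) {s : ℝ} (hs : 0 < s)
    (f : (Fin m → ℝ) → ℝ≥0∞) :
    ∫⁻ z, f (a + s • (z - b)) = ENNReal.ofReal ((s ^ m)⁻¹) * ∫⁻ x, f x := by
  rw [lintegral_sub_right_eq_self (fun z => f (a + s • z)) b]
  have hemb : MeasurableEmbedding (fun z : Fin m → ℝ => s • z) :=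
    (Homeomorph.smulOfNeZero s hs.ne').measurableEmbedding
  rw [← hemb.lintegral_map (fun z => f (a + z)),
    Measure.map_addHaar_smul volume hs.ne', lintegral_smul_measure,
    lintegral_add_left_eq_self f a]
  simp [abs_of_pos (pow_pos hs m)]

lemma lintegral_Ici_inv_pow (k : ℕ) {a : ℝ} (ha : 0 < a) :
    ∫⁻ s in Ici a, ENNReal.ofReal ((s ^ (k + 2))⁻¹) =
      ENNReal.ofReal ((k + 1 : ℝ)⁻¹ * (a ^ (k + 1))⁻¹) := by
  rw [Measure.restrict_congr_set Ioi_ae_eq_Ici.symm]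
  have hlt : (-(k + 2 : ℝ)) < -1 := by linarith [k.cast_nonneg (α := ℝ)]
  have hint := integrableOn_Ioi_rpow_of_lt hlt ha
  have heq : ∀ s ∈ Ioi a, ENNReal.ofReal ((s ^ (k + 2))⁻¹) =
      ENNReal.ofReal (s ^ (-(k + 2 : ℝ))) := by
    intro s hs
    have hs0 : 0 < s := ha.trans hs
    rw [Real.rpow_neg hs0.le]
    congr 2
    exact_mod_cast (Real.rpow_natCast s (k + 2)).symm
  rw [setLIntegral_congr_fun measurableSet_Ioi heq, ← ofReal_integral_eq_lintegral_ofReal hint,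
    integral_Ioi_rpow_of_lt hlt ha]
  · congr 1
    have h1 : (-(k + 2 : ℝ)) + 1 = -((k + 1 : ℕ) : ℝ) := by push_cast; ring
    rw [h1, Real.rpow_neg ha.le, Real.rpow_natCast]
    push_cast
    field_simp
  · filter_upwards [ae_restrict_mem measurableSet_Ioi] with s hs
    exact Real.rpow_nonneg (ha.trans hs).le _

/-- A function controlled along segments by `D` is controlled by the Riesz potential of `D`. -/
lemma lintegral_sub_le_potential {k : ℕ} {c : Fin (k + 1) → ℝ} {R : ℝ} (hR : 0 < R)
    {w : (Fin (k + 1) → ℝ) → ℝ} {D : (Fin (k + 1) → ℝ) → ℝ≥0∞} (hD : Measurable D)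
    (hw : ∀ y ∈ closedBall c R, ∀ z ∈ closedBall c R,
      ‖w y - w z‖ₑ ≤ ENNReal.ofReal ‖z - y‖ * ∫⁻ s in Ioo (0 : ℝ) 1, D (y + s • (z - y)))
    {y : Fin (k + 1) → ℝ} (hy : y ∈ closedBall c R) :
    ∫⁻ z in closedBall c R, ‖w y - w z‖ₑ ≤ ∫⁻ x in closedBall c R,
      ENNReal.ofReal (2 * R / (k + 1) * (2 * R / ‖x - y‖) ^ k) * D x := by
  set K := closedBall c R with hK
  have hKm : MeasurableSet K := measurableSet_closedBall
  have hKc : Convex ℝ K := convex_closedBall c R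
  let Φ : ℝ → (Fin (k + 1) → ℝ) → ℝ≥0∞ := fun s x =>
    K.indicator (fun x => (Ici (‖x - y‖ / (2 * R))).indicator
      (fun s => ENNReal.ofReal (‖x - y‖ / s) * D x) s) x
  have hΦm : Measurable (Function.uncurry Φ) := by
    have h1 : MeasurableSet {p : ℝ × (Fin (k + 1) → ℝ) | p.2 ∈ K} := measurable_snd hKm
    have h2 : MeasurableSet {p : ℝ × (Fin (k + 1) → ℝ) | ‖p.2 - y‖ / (2 * R) ≤ p.1} :=
      measurableSet_le (by fun_prop) (by fun_prop)
    have h3 : Measurable fun p : ℝ × (Fin (k + 1) → ℝ) =>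
      ENNReal.ofReal (‖p.2 - y‖ / p.1) * D p.2 := by fun_prop
    exact ((h3.indicator h2).indicator h1)
  calc ∫⁻ z in K, ‖w y - w z‖ₑ
      ≤ ∫⁻ z in K, ∫⁻ s in Ioo (0 : ℝ) 1, ENNReal.ofReal ‖z - y‖ * D (y + s • (z - y)) := by
        refine setLIntegral_mono' hKm fun z hz => ?_
        rw [lintegral_const_mul' _ _ ENNReal.ofReal_ne_top]
        exact hw y hy z hz
    _ = ∫⁻ s in Ioo (0 : ℝ) 1, ∫⁻ z in K, ENNReal.ofReal ‖z - y‖ * D (y + s • (z - y)) := by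
        rw [lintegral_lintegral_swap]
        apply Measurable.aemeasurable
        fun_prop
    _ ≤ ∫⁻ s in Ioo (0 : ℝ) 1, ∫⁻ x, ENNReal.ofReal ((s ^ (k + 1))⁻¹) * Φ s x := by
        refine setLIntegral_mono' measurableSet_Ioo fun s hs => ?_
        rw [lintegral_const_mul' _ _ ENNReal.ofReal_ne_top,
          ← lintegral_comp_homothety y y hs.1, ← lintegral_indicator hKm]
        refine lintegral_mono fun z => ?_
        by_cases hz : z ∈ K
        · have hmem : y + s • (z - y) ∈ K := by
            have := hKc hy hz (by linarith [hs.2] : 0 ≤ 1 - s) hs.1.le (by ring)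
            convert this using 1
            rw [sub_smul, one_smul, smul_sub]; abel
          have hn : ‖y + s • (z - y) - y‖ = s * ‖z - y‖ := by
            rw [add_sub_cancel_left, norm_smul, Real.norm_of_nonneg hs.1.le]
          have hd : ‖z - y‖ ≤ 2 * R := by
            have h1 : dist z c ≤ R := hz
            have h2 : dist y c ≤ R := hy
            rw [← dist_eq_norm]
            linarith [dist_triangle_right z y c]
          have hle : ‖y + s • (z - y) - y‖ / (2 * R) ≤ s := by
            rw [hn, div_le_iff₀ (by positivity)]
            exact mul_le_mul_of_nonneg_left hd hs.1.le
          simp only [Φ, indicator_of_mem hz, indicator_of_mem hmem]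
          rw [indicator_of_mem (show s ∈ Ici _ from hle), hn, mul_div_cancel_left₀ _ hs.1.ne']
        · simp [hz]
    _ = ∫⁻ x, ∫⁻ s in Ioo (0 : ℝ) 1, ENNReal.ofReal ((s ^ (k + 1))⁻¹) * Φ s x := by
        rw [lintegral_lintegral_swap]
        apply Measurable.aemeasurable
        exact Measurable.mul (by fun_prop) hΦm
    _ ≤ ∫⁻ x, K.indicator (fun x =>
          ENNReal.ofReal (2 * R / (k + 1) * (2 * R / ‖x - y‖) ^ k) * D x) x := by
        have hne : ∀ᵐ x : Fin (k + 1) → ℝ, x ≠ y := by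
          simp [ae_iff]
        refine lintegral_mono_ae ?_
        filter_upwards [hne] with x hxy
        by_cases hx : x ∈ K
        · have hpos : 0 < ‖x - y‖ := norm_pos_iff.2 (sub_ne_zero.2 hxy)
          simp only [Φ, indicator_of_mem hx]
          calc ∫⁻ s in Ioo (0 : ℝ) 1, ENNReal.ofReal ((s ^ (k + 1))⁻¹) *
                (Ici (‖x - y‖ / (2 * R))).indicator
                  (fun s => ENNReal.ofReal (‖x - y‖ / s) * D x) s
              ≤ ∫⁻ s, (Ici (‖x - y‖ / (2 * R))).indicator (fun s =>
                ENNReal.ofReal ((s ^ (k + 2))⁻¹) * (ENNReal.ofReal ‖x - y‖ * D x)) s := by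
                refine (setLIntegral_le_lintegral _ _).trans (lintegral_mono fun s => ?_)
                by_cases hs : s ∈ Ici (‖x - y‖ / (2 * R))
                · have hs0 : 0 < s := lt_of_lt_of_le (by positivity) hs
                  simp only [indicator_of_mem hs]
                  rw [← mul_assoc, ← mul_assoc, ← ENNReal.ofReal_mul (by positivity),
                    ← ENNReal.ofReal_mul (by positivity)]
                  refine le_of_eq ?_
                  congr 2
                  field_simp
                  ring
                · simp [hs]
            _ = ENNReal.ofReal ((k + 1 : ℝ)⁻¹ * ((‖x - y‖ / (2 * R)) ^ (k + 1))⁻¹) *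
                  (ENNReal.ofReal ‖x - y‖ * D x) := by
                rw [lintegral_indicator measurableSet_Ici, lintegral_mul_const _ (by fun_prop),
                  lintegral_Ici_inv_pow k (by positivity)]
            _ ≤ _ := by
                rw [← mul_assoc, ← ENNReal.ofReal_mul (by positivity)]
                refine le_of_eq ?_
                congr 2
                field_simp
                rw [div_pow, div_pow]
                field_simp
                ring
        · simp [Φ, hx]
    _ = _ := lintegral_indicator hKm _

/-- The normalised integral of `G` composed with the Riesz kernel. -/
def kernelMean (k : ℕ) (G : ℝ → ℝ≥0∞) (t : ℝ) : ℝ≥0∞ :=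
  ∫⁻ x in closedBall (0 : Fin (k + 1) → ℝ) 1, G (t * (1 / ‖x‖) ^ k)

lemma lintegral_closedBall_kernel {k : ℕ} {R : ℝ} (hR : 0 < R) (y : Fin (k + 1) → ℝ)
    (G : ℝ → ℝ≥0∞) (t : ℝ) :
    ∫⁻ x in closedBall y (2 * R), G (t * (2 * R / ‖x - y‖) ^ k) =
      ENNReal.ofReal ((2 * R) ^ (k + 1)) * kernelMean k G t := by
  have h := lintegral_comp_homothety 0 y (s := (2 * R)⁻¹) (by positivity)
    ((closedBall (0 : Fin (k + 1) → ℝ) 1).indicator fun x => G (t * (1 / ‖x‖) ^ k))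
  rw [lintegral_indicator measurableSet_closedBall] at h
  rw [kernelMean, ← lintegral_indicator measurableSet_closedBall]
  convert h using 1
  · refine lintegral_congr fun x => ?_
    have hn : ‖0 + (2 * R)⁻¹ • (x - y)‖ = ‖x - y‖ / (2 * R) := by
      rw [zero_add, norm_smul, Real.norm_of_nonneg (by positivity)]; field_simp
    by_cases hx : x ∈ closedBall y (2 * R)
    · have : 0 + (2 * R)⁻¹ • (x - y) ∈ closedBall (0 : Fin (k + 1) → ℝ) 1 := by
        rw [mem_closedBall_zero_iff, hn, div_le_one (by positivity), ← dist_eq_norm]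
        exact hx
      rw [indicator_of_mem hx, indicator_of_mem this, hn, one_div_div]
    · have : 0 + (2 * R)⁻¹ • (x - y) ∉ closedBall (0 : Fin (k + 1) → ℝ) 1 := by
        rw [mem_closedBall_zero_iff, hn, div_le_one (by positivity), ← dist_eq_norm]
        exact hx
      rw [indicator_of_notMem hx, indicator_of_notMem this]
  · rw [inv_pow, inv_inv]

end Potential

section SliceOscillation

variable {k : ℕ} {c : Fin (k + 1) → ℝ} {R N t : ℝ} {w : (Fin (k + 1) → ℝ) → ℝ}
  {D E : (Fin (k + 1) → ℝ) → ℝ≥0∞} {G : ℝ → ℝ≥0∞}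

lemma lintegral_sub_le_kernelMean (hR : 0 < R) (ht : 0 ≤ t) (hD : Measurable D)
    (hE : Measurable E)
    (hw : ∀ y ∈ closedBall c R, ∀ z ∈ closedBall c R,
      ‖w y - w z‖ₑ ≤ ENNReal.ofReal (N * ‖z - y‖) * ∫⁻ s in Ioo (0 : ℝ) 1, D (y + s • (z - y)))
    (hDE : ∀ x ∈ closedBall c R, ∀ τ : ℝ, 0 ≤ τ → ENNReal.ofReal τ * D x ≤ E x + G τ)
    {y : Fin (k + 1) → ℝ} (hy : y ∈ closedBall c R) :
    ENNReal.ofReal t * ∫⁻ z in closedBall c R, ‖w y - w z‖ₑ ≤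
      ENNReal.ofReal (2 * R * N) * ((∫⁻ x in closedBall c R, E x) +
        ENNReal.ofReal ((2 * R) ^ (k + 1)) * kernelMean k G t) := by
  have hpot := lintegral_sub_le_potential hR (D := fun x => ENNReal.ofReal N * D x)
    (hD.const_mul _) (w := w) (c := c) (fun y hy z hz => by
      rw [lintegral_const_mul' _ _ ENNReal.ofReal_ne_top, ← mul_assoc,
        ← ENNReal.ofReal_mul (norm_nonneg _), mul_comm ‖z - y‖ N]
      exact hw y hy z hz) hy
  have hsub : closedBall c R ⊆ closedBall y (2 * R) := by
    intro x hx
    have h1 : dist x c ≤ R := hx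
    have h2 : dist y c ≤ R := hy
    exact mem_closedBall.2 (by linarith [dist_triangle_right x y c])
  calc ENNReal.ofReal t * ∫⁻ z in closedBall c R, ‖w y - w z‖ₑ
      ≤ ENNReal.ofReal t * ∫⁻ x in closedBall c R,
        ENNReal.ofReal (2 * R / (k + 1) * (2 * R / ‖x - y‖) ^ k) * (ENNReal.ofReal N * D x) := by
        gcongr
    _ = ∫⁻ x in closedBall c R, ENNReal.ofReal t * (
        ENNReal.ofReal (2 * R / (k + 1) * (2 * R / ‖x - y‖) ^ k) * (ENNReal.ofReal N * D x)) :=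
        (lintegral_const_mul' _ _ ENNReal.ofReal_ne_top).symm
    _ ≤ ∫⁻ x in closedBall c R, ENNReal.ofReal (2 * R * N) *
        (E x + G (t * (2 * R / ‖x - y‖) ^ k)) := by
        refine setLIntegral_mono' measurableSet_closedBall fun x hx => ?_
        have h1 : ENNReal.ofReal (2 * R / (k + 1) * (2 * R / ‖x - y‖) ^ k) ≤
            ENNReal.ofReal (2 * R) * ENNReal.ofReal ((2 * R / ‖x - y‖) ^ k) := by
          rw [← ENNReal.ofReal_mul (by positivity)]
          gcongr
          exact div_le_self (by positivity) (by linarith [k.cast_nonneg (α := ℝ)])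
        calc _ ≤ ENNReal.ofReal t * (ENNReal.ofReal (2 * R) *
              ENNReal.ofReal ((2 * R / ‖x - y‖) ^ k) * (ENNReal.ofReal N * D x)) := by gcongr
          _ = ENNReal.ofReal (2 * R) * ENNReal.ofReal N *
              (ENNReal.ofReal t * ENNReal.ofReal ((2 * R / ‖x - y‖) ^ k) * D x) := by ring
          _ ≤ _ := by
            rw [← ENNReal.ofReal_mul (by positivity), ← ENNReal.ofReal_mul ht]
            gcongr
            exact hDE x hx _ (by positivity)
    _ = ENNReal.ofReal (2 * R * N) * ((∫⁻ x in closedBall c R, E x) +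
        ∫⁻ x in closedBall c R, G (t * (2 * R / ‖x - y‖) ^ k)) := by
        rw [lintegral_const_mul' _ _ ENNReal.ofReal_ne_top, lintegral_add_left hE]
    _ ≤ _ := by
        rw [← lintegral_closedBall_kernel hR y G t]
        gcongr

lemma volume_closedBall_pi (c : Fin (k + 1) → ℝ) (hR : 0 ≤ R) :
    volume (closedBall c R) = ENNReal.ofReal ((2 * R) ^ (k + 1)) := by
  rw [Real.volume_pi_closedBall _ hR, Fintype.card_fin]

lemma osc_le_kernelMean (hR : 0 < R) (hN : 0 ≤ N) (ht : 0 ≤ t) (hD : Measurable D)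
    (hE : Measurable E) (hwm : Measurable w)
    (hw : ∀ y ∈ closedBall c R, ∀ z ∈ closedBall c R,
      ‖w y - w z‖ₑ ≤ ENNReal.ofReal (N * ‖z - y‖) * ∫⁻ s in Ioo (0 : ℝ) 1, D (y + s • (z - y)))
    (hDE : ∀ x ∈ closedBall c R, ∀ τ : ℝ, 0 ≤ τ → ENNReal.ofReal τ * D x ≤ E x + G τ)
    {y y' : Fin (k + 1) → ℝ} (hy : y ∈ closedBall c R) (hy' : y' ∈ closedBall c R) :
    ENNReal.ofReal (t * (2 * R) ^ (k + 1)) * ‖w y - w y'‖ₑ ≤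
      ENNReal.ofReal (4 * R * N) * ((∫⁻ x in closedBall c R, E x) +
        ENNReal.ofReal ((2 * R) ^ (k + 1)) * kernelMean k G t) := by
  have h1 := lintegral_sub_le_kernelMean hR ht hD hE hw hDE hy
  have h2 := lintegral_sub_le_kernelMean hR ht hD hE hw hDE hy'
  calc ENNReal.ofReal (t * (2 * R) ^ (k + 1)) * ‖w y - w y'‖ₑ
      = ENNReal.ofReal t * ∫⁻ z in closedBall c R, ‖w y - w y'‖ₑ := by
        rw [setLIntegral_const, volume_closedBall_pi c hR.le, ENNReal.ofReal_mul ht]; ring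
    _ ≤ ENNReal.ofReal t * ∫⁻ z in closedBall c R, (‖w y - w z‖ₑ + ‖w y' - w z‖ₑ) := by
        gcongr with z
        rw [show w y - w y' = (w y - w z) - (w y' - w z) by ring]
        exact enorm_sub_le
    _ = ENNReal.ofReal t * (∫⁻ z in closedBall c R, ‖w y - w z‖ₑ) +
        ENNReal.ofReal t * ∫⁻ z in closedBall c R, ‖w y' - w z‖ₑ := by
        rw [lintegral_add_left (by fun_prop), mul_add]
    _ ≤ _ := add_le_add h1 h2
    _ = _ := by
        rw [← add_mul, ← ENNReal.ofReal_add (by positivity) (by positivity)]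
        congr 2; ring

end SliceOscillation

section Segment

variable {n : ℕ}

lemma norm_toLp_le (x : Fin n → ℝ) : ‖(WithLp.toLp 2 x : Euc n)‖ ≤ n * ‖x‖ := by
  rw [EuclideanSpace.norm_eq]
  refine Real.sqrt_le_iff.2 ⟨by positivity, ?_⟩
  have h : ∀ i ∈ (Finset.univ : Finset (Fin n)), ‖(WithLp.toLp 2 x : Euc n) i‖ ^ 2 ≤ ‖x‖ ^ 2 :=
    fun i _ => by gcongr; exact norm_le_pi_norm x i
  refine (Finset.sum_le_card_nsmul _ _ _ h).trans ?_
  simp only [Finset.card_univ, Fintype.card_fin, nsmul_eq_mul, mul_pow]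
  gcongr
  rcases n.eq_zero_or_pos with rfl | hn
  · simp
  · have : (1 : ℝ) ≤ n := by exact_mod_cast hn
    nlinarith

lemma norm_gradient (v : Euc n → ℝ) (x : Euc n) : ‖gradient v x‖ = ‖fderiv ℝ v x‖ := by
  simp [gradient]

lemma enorm_sub_le_segment {v : Euc n → ℝ} (hv : ContDiff ℝ (⊤ : ℕ∞) v) (p q : Euc n) :
    ‖v p - v q‖ₑ ≤ ENNReal.ofReal ‖q - p‖ *
      ∫⁻ s in Ioo (0 : ℝ) 1, ‖gradient v (p + s • (q - p))‖ₑ := by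
  have hd : ∀ s : ℝ, HasDerivAt (fun s : ℝ => v (p + s • (q - p)))
      (fderiv ℝ v (p + s • (q - p)) (q - p)) s := by
    intro s
    have h1 : HasDerivAt (fun s : ℝ => p + s • (q - p)) (q - p) s := by
      simpa using ((hasDerivAt_id s).smul_const (q - p)).const_add p
    exact ((hv.differentiable (by simp) _).hasFDerivAt).comp_hasDerivAt s h1
  have hc : Continuous fun s : ℝ => fderiv ℝ v (p + s • (q - p)) (q - p) := by
    have := hv.continuous_fderiv (by simp)
    fun_prop
  have hint := intervalIntegral.integral_eq_sub_of_hasDerivAt (a := 0) (b := 1)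
    (fun s _ => hd s) (hc.intervalIntegrable 0 1)
  have heq : v q - v p = ∫ s in Ioo (0 : ℝ) 1, fderiv ℝ v (p + s • (q - p)) (q - p) := by
    rw [← integral_Ioc_eq_integral_Ioo, ← intervalIntegral.integral_of_le zero_le_one, hint]
    simp
  rw [← enorm_neg, neg_sub, heq, ← lintegral_const_mul' _ _ ENNReal.ofReal_ne_top]
  refine (enorm_integral_le_lintegral_enorm _).trans (lintegral_mono fun s => ?_)
  rw [ofReal_norm, mul_comm, ← ofReal_norm, ← ofReal_norm,
    ← ofReal_norm, norm_gradient, ← ENNReal.ofReal_mul (norm_nonneg _)]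
  exact ENNReal.ofReal_le_ofReal (ContinuousLinearMap.le_opNorm _ _)

/-- The point of `ℝⁿ⁺¹` with `i`-th coordinate `a` and remaining coordinates `y`. -/
def slicePt (i : Fin (n + 1)) (a : ℝ) (y : Fin n → ℝ) : Euc (n + 1) :=
  WithLp.toLp 2 (i.insertNth a y)

@[simp] lemma slicePt_same (i : Fin (n + 1)) (a : ℝ) (y : Fin n → ℝ) : slicePt i a y i = a := by
  simp [slicePt]

@[simp] lemma slicePt_succAbove (i : Fin (n + 1)) (a : ℝ) (y : Fin n → ℝ) (j : Fin n) :
    slicePt i a y (i.succAbove j) = y j := by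
  simp [slicePt]

lemma slicePt_removeNth (i : Fin (n + 1)) (x : Euc (n + 1)) :
    slicePt i (x i) (i.removeNth (x : Fin (n + 1) → ℝ)) = x := by
  ext j
  simp [slicePt]

lemma continuous_slicePt (i : Fin (n + 1)) :
    Continuous fun p : ℝ × (Fin n → ℝ) => slicePt i p.1 p.2 := by
  refine (PiLp.continuous_toLp 2 _).comp (continuous_pi fun j => ?_)
  refine Fin.succAboveCases i ?_ (fun j => ?_) j
  · simpa using continuous_fst
  · simp only [Fin.insertNth_apply_succAbove]
    fun_prop

lemma slicePt_segment (i : Fin (n + 1)) (a : ℝ) (y z : Fin n → ℝ) (s : ℝ) :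
    slicePt i a y + s • (slicePt i a z - slicePt i a y) = slicePt i a (y + s • (z - y)) := by
  ext j
  refine Fin.succAboveCases i ?_ (fun j => ?_) j <;> simp

lemma norm_slicePt_sub_le (i : Fin (n + 1)) (a : ℝ) (y z : Fin n → ℝ) :
    ‖slicePt i a z - slicePt i a y‖ ≤ ((n + 1 : ℕ) : ℝ) * ‖z - y‖ := by
  rw [slicePt, slicePt, ← WithLp.toLp_sub]
  refine (norm_toLp_le _).trans ?_
  gcongr
  refine (pi_norm_le_iff_of_nonneg (norm_nonneg _)).2 fun j => ?_
  refine Fin.succAboveCases i ?_ (fun j => ?_) j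
  · simp
  · simpa using norm_le_pi_norm (z - y) j

lemma slice_osc_le {k : ℕ} {c : Fin (k + 1) → ℝ} {R t a : ℝ} (hR : 0 < R) (ht : 0 ≤ t)
    {v : Euc (k + 2) → ℝ} (hv : ContDiff ℝ (⊤ : ℕ∞) v) {E : Euc (k + 2) → ℝ≥0∞}
    (hE : Measurable E) {G : ℝ → ℝ≥0∞} (i : Fin (k + 2))
    (hvE : ∀ y ∈ closedBall c R, ∀ τ : ℝ, 0 ≤ τ →
      ENNReal.ofReal (τ * ‖gradient v (slicePt i a y)‖) ≤ E (slicePt i a y) + G τ)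
    {y y' : Fin (k + 1) → ℝ} (hy : y ∈ closedBall c R) (hy' : y' ∈ closedBall c R) :
    ENNReal.ofReal (t * (2 * R) ^ (k + 1)) * ‖v (slicePt i a y) - v (slicePt i a y')‖ₑ ≤
      ENNReal.ofReal (4 * R * ((k + 2 : ℕ) : ℝ)) *
        ((∫⁻ x in closedBall c R, E (slicePt i a x)) +
        ENNReal.ofReal ((2 * R) ^ (k + 1)) * kernelMean k G t) := by
  have hs : Continuous (slicePt i a) :=
    (continuous_slicePt i).comp (f := fun y => (a, y)) (by fun_prop)
  have hgc : Continuous fun x => ‖gradient v x‖ := by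
    simp_rw [norm_gradient]
    exact (hv.continuous_fderiv (by simp)).norm
  have hg : Measurable fun x => ‖gradient v (slicePt i a x)‖ₑ := by
    simp_rw [← ofReal_norm]
    exact (hgc.comp hs).measurable.ennreal_ofReal
  refine osc_le_kernelMean (w := fun y => v (slicePt i a y)) (E := fun y => E (slicePt i a y))
    (D := fun y => ‖gradient v (slicePt i a y)‖ₑ) hR (by positivity) ht hg
    (hE.comp hs.measurable) (hv.continuous.comp hs).measurable ?_ ?_ hy hy'
  · intro y _ z _
    refine (enorm_sub_le_segment hv _ _).trans ?_
    simp_rw [slicePt_segment]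
    gcongr
    exact norm_slicePt_sub_le i a y z
  · intro x hx τ hτ
    rw [← ofReal_norm, ← ENNReal.ofReal_mul hτ]
    exact hvE x hx τ hτ

end Segment

section Box

lemma lintegral_slicePt {n : ℕ} (i : Fin (n + 1)) {H : Euc (n + 1) → ℝ≥0∞} (hH : Measurable H) :
    ∫⁻ a, ∫⁻ y, H (slicePt i a y) = ∫⁻ x, H x := by
  have h1 := (EuclideanSpace.volume_preserving_symm_measurableEquiv_toLp
    (Fin (n + 1))).symm.lintegral_comp_emb (MeasurableEquiv.measurableEmbedding _) H
  have h2 := (volume_preserving_piFinSuccAbove (fun _ : Fin (n + 1) => ℝ) i).symm.lintegral_comp_emb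
    (MeasurableEquiv.measurableEmbedding _) (fun x => H (WithLp.toLp 2 x))
  have hs : Measurable fun p : ℝ × (Fin n → ℝ) => H (slicePt i p.1 p.2) :=
    hH.comp (continuous_slicePt i).measurable
  rw [← h1, lintegral_lintegral hs.aemeasurable]
  exact h2

/-- The cube corner `c + ρ(1,…,1)`. -/
def corner {n : ℕ} (c : Euc n) (ρ : ℝ) : Euc n := WithLp.toLp 2 fun i => c i + ρ

lemma abs_sub_corner_le {k : ℕ} {c : Euc (k + 2)} {ρ ω : ℝ} (hρ : 0 < ρ) (hω : 0 ≤ ω)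
    {f : Euc (k + 2) → ℝ}
    (hf : ∀ i, ∀ p ∈ closedCube c ρ, ∀ q ∈ closedCube c ρ, p i = q i → |p i - c i| = ρ →
      |f p - f q| ≤ ω)
    {x : Euc (k + 2)} (hx : x ∈ closedCube c ρ) {i : Fin (k + 2)} (hi : |x i - c i| = ρ) :
    |f x - f (corner c ρ)| ≤ 2 * ω := by
  have hc : ∀ j, corner c ρ j = c j + ρ := fun j => rfl
  have hmem : corner c ρ ∈ closedCube c ρ := fun j => by
    rw [hc, add_sub_cancel_left, abs_of_pos hρ]
  rcases (abs_eq hρ.le).1 hi with h | h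
  · have := hf i x hx _ hmem (by rw [hc]; linarith) hi
    linarith
  · let P : Euc (k + 2) := WithLp.toLp 2 (Function.update (fun j => c j + ρ) i (c i - ρ))
    have hPi : P i = c i - ρ := by simp [P]
    have hPj : ∀ j, j ≠ i → P j = c j + ρ := fun j hj => by simp [P, hj]
    have hPm : P ∈ closedCube c ρ := fun j => by
      by_cases hj : j = i
      · subst hj; rw [hPi, sub_sub_cancel_left, abs_neg, abs_of_pos hρ]
      · rw [hPj j hj, add_sub_cancel_left, abs_of_pos hρ]
    obtain ⟨j, hj⟩ := exists_ne i
    have h1 := hf i x hx P hPm (by rw [hPi]; linarith) hi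
    have h2 := hf j P hPm _ hmem (by rw [hPj j hj, hc])
      (by rw [hPj j hj, add_sub_cancel_left, abs_of_pos hρ])
    have := abs_sub_le (f x) (f P) (f (corner c ρ))
    linarith

/-- The sum over the faces of the cube of half-side `ρ` of the integrals of `H` over the
concentric faces of half-side `R`. -/
def faceSum {n : ℕ} (c : Euc (n + 1)) (R : ℝ) (H : Euc (n + 1) → ℝ≥0∞) (ρ : ℝ) : ℝ≥0∞ :=
  ∑ i, ((∫⁻ y in closedBall (i.removeNth (c : Fin (n + 1) → ℝ)) R, H (slicePt i (c i + ρ) y)) +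
    ∫⁻ y in closedBall (i.removeNth (c : Fin (n + 1) → ℝ)) R, H (slicePt i (c i - ρ) y))

lemma measurable_face {n : ℕ} (s : Set (Fin n → ℝ)) {H : Euc (n + 1) → ℝ≥0∞}
    (hH : Measurable H) (i : Fin (n + 1)) :
    Measurable fun a => ∫⁻ y in s, H (slicePt i a y) :=
  Measurable.lintegral_prod_right' (f := fun p : ℝ × (Fin n → ℝ) => H (slicePt i p.1 p.2))
    (hH.comp (continuous_slicePt i).measurable)

lemma measurable_faceSum {n : ℕ} (c : Euc (n + 1)) (R : ℝ) {H : Euc (n + 1) → ℝ≥0∞}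
    (hH : Measurable H) : Measurable (faceSum c R H) := by
  refine Finset.measurable_sum _ fun i _ => ?_
  exact ((measurable_face _ hH i).comp (measurable_const_add _)).add
    ((measurable_face _ hH i).comp (measurable_const_sub _))

lemma lintegral_faceSum_le {n : ℕ} (c : Euc (n + 1)) (R : ℝ) {H : Euc (n + 1) → ℝ≥0∞}
    (hH : Measurable H) :
    ∫⁻ ρ, faceSum c R H ρ ≤ 2 * ((n + 1 : ℕ) : ℝ≥0∞) * ∫⁻ x, H x := by
  have key : ∀ (s : Set (Fin n → ℝ)) (i : Fin (n + 1)),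
      ∫⁻ a, ∫⁻ y in s, H (slicePt i a y) ≤ ∫⁻ x, H x := fun s i => by
    rw [← lintegral_slicePt i hH]
    exact lintegral_mono fun a => setLIntegral_le_lintegral _ _
  simp only [faceSum]
  rw [lintegral_finsetSum]
  · calc _ ≤ ∑ i : Fin (n + 1), 2 * ∫⁻ x, H x := by
          refine Finset.sum_le_sum fun i _ => ?_
          set K := closedBall (i.removeNth (c : Fin (n + 1) → ℝ)) R
          have hm : Measurable fun a => ∫⁻ y in K, H (slicePt i (c i + a) y) :=
            (measurable_face K hH i).comp (measurable_const_add _)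
          rw [lintegral_add_left hm,
            lintegral_add_left_eq_self (fun a => ∫⁻ y in K, H (slicePt i a y)) (c i),
            lintegral_sub_left_eq_self (fun a => ∫⁻ y in K, H (slicePt i a y)) (c i), two_mul]
          exact add_le_add (key K i) (key K i)
      _ = _ := by simp; ring
  · exact fun i _ => ((measurable_face _ hH i).comp (measurable_const_add _)).add
      ((measurable_face _ hH i).comp (measurable_const_sub _))

lemma face_le_faceSum {n : ℕ} {c : Euc (n + 1)} {R ρ : ℝ} (hρ : 0 ≤ ρ)
    (H : Euc (n + 1) → ℝ≥0∞) (i : Fin (n + 1)) {a : ℝ} (ha : |a - c i| = ρ) :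
    ∫⁻ y in closedBall (i.removeNth (c : Fin (n + 1) → ℝ)) R, H (slicePt i a y) ≤
      faceSum c R H ρ := by
  refine le_trans ?_ (Finset.single_le_sum (fun _ _ => zero_le) (Finset.mem_univ i))
  rcases (abs_eq hρ).1 ha with h | h
  · rw [show a = c i + ρ by linarith]; exact le_self_add
  · rw [show a = c i - ρ by linarith]; exact le_add_self

lemma removeNth_mem_closedBall {n : ℕ} {c x : Euc (n + 1)} {R : ℝ} (hR : 0 ≤ R)
    (hx : x ∈ closedCube c R) (i : Fin (n + 1)) :
    i.removeNth (x : Fin (n + 1) → ℝ) ∈ closedBall (i.removeNth (c : Fin (n + 1) → ℝ)) R :=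
  mem_closedBall.2 ((dist_pi_le_iff hR).2 fun j => hx (i.succAbove j))

lemma slicePt_mem_closedCube {n : ℕ} {c : Euc (n + 1)} {R a : ℝ} {i : Fin (n + 1)}
    (ha : |a - c i| ≤ R) {y : Fin n → ℝ}
    (hy : y ∈ closedBall (i.removeNth (c : Fin (n + 1) → ℝ)) R) :
    slicePt i a y ∈ closedCube c R := by
  intro j
  refine Fin.succAboveCases i ?_ (fun j => ?_) j
  · simpa using ha
  · simpa [Real.dist_eq, Fin.removeNth] using
      (dist_le_pi_dist y (i.removeNth (c : Fin (n + 1) → ℝ)) j).trans hy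

lemma exists_good_box {k : ℕ} {c : Euc (k + 2)} {R t : ℝ} (hR : 0 < R) (ht : 0 < t)
    {v : ℕ → Euc (k + 2) → ℝ} (hv : ∀ j, ContDiff ℝ (⊤ : ℕ∞) (v j))
    {E : ℕ → Euc (k + 2) → ℝ≥0∞} (hE : ∀ j, Measurable (E j)) {Q S : ℝ≥0∞}
    (hEQ : ∀ j, ∫⁻ x, E j x ≤ Q) {G : ℝ → ℝ≥0∞}
    (hvE : ∀ j, ∀ x ∈ closedCube c R, ∀ τ : ℝ, 0 ≤ τ →
      ENNReal.ofReal (τ * ‖gradient (v j) x‖) ≤ E j x + G τ)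
    {δ : ℝ} (hδ : 0 < δ) (hvδ : ∀ j x, ENNReal.ofReal δ * ‖v j x‖ₑ ≤ E j x)
    (hQ : 2 * ((k + 2 : ℕ) : ℝ≥0∞) * Q < S * ENNReal.ofReal (R / 2)) (hS : S ≠ ∞)
    {ω : ℝ} (hω : 0 < ω)
    (hSω : ENNReal.ofReal (4 * R * ((k + 2 : ℕ) : ℝ)) *
      (S + ENNReal.ofReal ((2 * R) ^ (k + 1)) * kernelMean k G t) ≤
      ENNReal.ofReal (t * (2 * R) ^ (k + 1) * ω)) :
    ∃ ρ ∈ Ioo (R / 2) R, ∃ p : ℝ, ∃ φ : ℕ → ℕ, StrictMono φ ∧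
      ∀ j, ∀ x ∈ closedCube c ρ, ∀ i, |x i - c i| = ρ → |v (φ j) x - p| ≤ 3 * ω := by
  obtain ⟨ρ, hρ, hlim⟩ : ∃ ρ ∈ Ioo (R / 2) R,
      liminf (fun j => faceSum c R (E j) ρ) atTop < S := by
    by_contra! hcon
    refine hQ.not_ge ?_
    calc S * ENNReal.ofReal (R / 2) = ∫⁻ _ in Ioo (R / 2) R, S := by
          rw [setLIntegral_const, Real.volume_Ioo]; congr 2; ring
      _ ≤ ∫⁻ ρ in Ioo (R / 2) R, liminf (fun j => faceSum c R (E j) ρ) atTop :=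
          setLIntegral_mono' measurableSet_Ioo hcon
      _ ≤ ∫⁻ ρ, liminf (fun j => faceSum c R (E j) ρ) atTop := setLIntegral_le_lintegral _ _
      _ ≤ liminf (fun j => ∫⁻ ρ, faceSum c R (E j) ρ) atTop :=
          lintegral_liminf_le fun j => measurable_faceSum c R (hE j)
      _ ≤ liminf (fun _ : ℕ => 2 * ((k + 2 : ℕ) : ℝ≥0∞) * Q) atTop := by
          refine liminf_le_liminf (Eventually.of_forall fun j => ?_)
          exact (lintegral_faceSum_le c R (hE j)).trans (by gcongr; exact hEQ j)
      _ = _ := liminf_const _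
  have hρ0 : 0 < ρ := by linarith [hρ.1]
  have hfreq := frequently_lt_of_liminf_lt (by isBoundedDefault) hlim
  obtain ⟨φ₁, hφ₁, hφS⟩ := extraction_of_frequently_atTop hfreq
  have hslice : ∀ j, ∀ i, ∀ a, |a - c i| = ρ →
      ∀ y ∈ closedBall (i.removeNth (c : Fin (k + 2) → ℝ)) R,
      ∀ y' ∈ closedBall (i.removeNth (c : Fin (k + 2) → ℝ)) R,
      |v (φ₁ j) (slicePt i a y) - v (φ₁ j) (slicePt i a y')| ≤ ω := by
    intro j i a ha y hy y' hy'
    have h := slice_osc_le hR ht.le (hv (φ₁ j)) (hE (φ₁ j)) (G := G) (a := a) i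
      (fun z hz τ hτ => hvE (φ₁ j) _ (slicePt_mem_closedCube (ha.le.trans hρ.2.le) hz) τ hτ) hy hy'
    have h2 := (h.trans (mul_le_mul_right (add_le_add_left
      ((face_le_faceSum hρ0.le (E (φ₁ j)) i ha).trans (hφS j).le) _) _)).trans hSω
    rw [← ofReal_norm, ← ENNReal.ofReal_mul (by positivity),
      ENNReal.ofReal_le_ofReal_iff (by positivity)] at h2
    exact le_of_mul_le_mul_left h2 (by positivity)
  have hosc : ∀ j, ∀ i, ∀ p ∈ closedCube c ρ, ∀ q ∈ closedCube c ρ, p i = q i →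
      |p i - c i| = ρ → |v (φ₁ j) p - v (φ₁ j) q| ≤ ω := by
    intro j i p hp q hq hpq hpi
    have := hslice j i (p i) hpi _
      (removeNth_mem_closedBall hR.le (closedCube_subset_closedCube c hρ.2.le hp) i) _
      (removeNth_mem_closedBall hR.le (closedCube_subset_closedCube c hρ.2.le hq) i)
    rwa [slicePt_removeNth, hpq, slicePt_removeNth] at this
  have hcm : corner c ρ ∈ closedCube c ρ := fun j => by
    simp [corner, abs_of_pos hρ0]
  have hbd : ∃ B : ℝ, ∀ j, v (φ₁ j) (corner c ρ) ∈ closedBall (0 : ℝ) B := by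
    let V := ENNReal.ofReal ((2 * R) ^ (k + 1))
    have hV0 : V ≠ 0 := by simp only [V, ne_eq, ENNReal.ofReal_eq_zero, not_le]; positivity
    have hδ0 : ENNReal.ofReal δ ≠ 0 := by simpa using hδ
    have hfin : ENNReal.ofReal ω + S / (ENNReal.ofReal δ * V) ≠ ∞ :=
      ENNReal.add_ne_top.2 ⟨ENNReal.ofReal_ne_top,
        ENNReal.div_ne_top hS (mul_ne_zero hδ0 hV0)⟩
    refine ⟨(ENNReal.ofReal ω + S / (ENNReal.ofReal δ * V)).toReal, fun j => ?_⟩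
    rw [mem_closedBall_zero_iff, ← ENNReal.ofReal_le_ofReal_iff ENNReal.toReal_nonneg,
      ENNReal.ofReal_toReal hfin, ofReal_norm]
    set K := closedBall (Fin.removeNth 0 (c : Fin (k + 2) → ℝ)) R
    have hcor : |corner c ρ 0 - c 0| = ρ := by simp [corner, abs_of_pos hρ0]
    have hle : ∀ y ∈ K, ENNReal.ofReal δ * ‖v (φ₁ j) (corner c ρ)‖ₑ ≤
        ENNReal.ofReal δ * ENNReal.ofReal ω + E (φ₁ j) (slicePt 0 (corner c ρ 0) y) := by
      intro y hy
      have h1 := hslice j 0 (corner c ρ 0) hcor _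
        (removeNth_mem_closedBall hR.le (closedCube_subset_closedCube c hρ.2.le hcm) 0) y hy
      rw [slicePt_removeNth] at h1
      refine le_trans ?_ (add_le_add_right (hvδ _ _) _)
      rw [← mul_add]
      gcongr
      calc ‖v (φ₁ j) (corner c ρ)‖ₑ = ‖(v (φ₁ j) (corner c ρ) -
            v (φ₁ j) (slicePt 0 (corner c ρ 0) y)) + v (φ₁ j) (slicePt 0 (corner c ρ 0) y)‖ₑ := by
              rw [sub_add_cancel]
        _ ≤ _ := enorm_add_le _ _
        _ ≤ _ := by
          gcongr
          rw [← ofReal_norm]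
          exact ENNReal.ofReal_le_ofReal h1
    have hint := setLIntegral_mono' (μ := volume) measurableSet_closedBall hle
    rw [setLIntegral_const, volume_closedBall_pi _ hR.le, lintegral_add_left measurable_const,
      setLIntegral_const, volume_closedBall_pi _ hR.le] at hint
    have h3 := hint.trans (add_le_add_right
      ((face_le_faceSum hρ0.le (E (φ₁ j)) 0 hcor).trans (hφS j).le) _)
    have hδV0 : ENNReal.ofReal δ * V ≠ 0 := mul_ne_zero hδ0 hV0
    have hδVt : ENNReal.ofReal δ * V ≠ ∞ := ENNReal.mul_ne_top ENNReal.ofReal_ne_top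
      ENNReal.ofReal_ne_top
    refine (ENNReal.mul_le_mul_iff_right hδV0 hδVt).1 ?_
    rw [mul_add, ENNReal.mul_div_cancel hδV0 hδVt]
    calc _ = ENNReal.ofReal δ * ‖v (φ₁ j) (corner c ρ)‖ₑ * V := by ring
      _ ≤ _ := h3
      _ = _ := by simp only [V]; ring
  obtain ⟨B, hB⟩ := hbd
  obtain ⟨p, -, φ₂, hφ₂, hp⟩ := tendsto_subseq_of_bounded isBounded_closedBall hB
  obtain ⟨N, hN⟩ := (Metric.tendsto_atTop.1 hp) ω hω
  refine ⟨ρ, hρ, p, fun j => φ₁ (φ₂ (j + N)), hφ₁.comp (hφ₂.comp (strictMono_id.add_const N)), ?_⟩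
  intro j x hx i hi
  have h1 := abs_sub_corner_le hρ0 hω.le (hosc (φ₂ (j + N))) hx hi
  have h2 := hN (j + N) (Nat.le_add_left _ _)
  rw [Real.dist_eq] at h2
  have := abs_sub_le (v (φ₁ (φ₂ (j + N))) x) (v (φ₁ (φ₂ (j + N))) (corner c ρ)) p
  simp only [Function.comp_apply] at h2
  linarith

end Box

section Truncation

/-- A smooth function vanishing on `(-∞,0]` and equal to the identity on `[1,∞)`. -/
def smoothPos (s : ℝ) : ℝ := s * Real.smoothTransition s

lemma contDiff_smoothPos : ContDiff ℝ (⊤ : ℕ∞) smoothPos :=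
  contDiff_id.mul Real.smoothTransition.contDiff

lemma smoothPos_of_nonpos {s : ℝ} (hs : s ≤ 0) : smoothPos s = 0 := by
  rw [smoothPos, Real.smoothTransition.zero_of_nonpos hs, mul_zero]

lemma smoothPos_of_one_le {s : ℝ} (hs : 1 ≤ s) : smoothPos s = s := by
  rw [smoothPos, Real.smoothTransition.one_of_one_le hs, mul_one]

lemma abs_smoothPos_sub_le (s : ℝ) : |smoothPos s - max s 0| ≤ 1 := by
  rcases le_total s 0 with h | h
  · simp [smoothPos_of_nonpos h, h]
  rcases le_total 1 s with h1 | h1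
  · simp [smoothPos_of_one_le h1, h]
  · rw [max_eq_left h, smoothPos]
    have h2 := Real.smoothTransition.nonneg s
    have h3 := Real.smoothTransition.le_one s
    rw [abs_le]
    constructor <;> nlinarith

lemma deriv_smoothPos_of_neg {s : ℝ} (hs : s < 0) : deriv smoothPos s = 0 := by
  have : smoothPos =ᶠ[𝓝 s] fun _ => 0 := by
    filter_upwards [Iio_mem_nhds hs] with x hx using smoothPos_of_nonpos hx.le
  rw [this.deriv_eq, deriv_const]

lemma deriv_smoothPos_of_one_lt {s : ℝ} (hs : 1 < s) : deriv smoothPos s = 1 := by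
  have : smoothPos =ᶠ[𝓝 s] id := by
    filter_upwards [Ioi_mem_nhds hs] with x hx using smoothPos_of_one_le hx.le
  rw [this.deriv_eq, deriv_id]

lemma exists_deriv_smoothPos_bound : ∃ B : ℝ, ∀ s, |deriv smoothPos s| ≤ B := by
  have hc : Continuous (deriv smoothPos) := contDiff_smoothPos.continuous_deriv (by simp)
  obtain ⟨B, hB⟩ := isCompact_Icc.exists_bound_of_continuousOn (s := Icc (0 : ℝ) 1) hc.continuousOn
  refine ⟨max B 1, fun s => ?_⟩
  rcases lt_or_ge s 0 with h | h
  · rw [deriv_smoothPos_of_neg h]; simp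
  rcases lt_or_ge 1 s with h1 | h1
  · rw [deriv_smoothPos_of_one_lt h1]; simp
  · exact (hB s ⟨h, h1⟩).trans (le_max_left _ _)

/-- A smooth approximation of the truncation `s ↦ (s - M)₊ - (m - s)₊`. -/
def smoothTrunc (m M : ℝ) (k : ℕ) (s : ℝ) : ℝ :=
  smoothPos ((k + 1) * (s - M)) / (k + 1) - smoothPos ((k + 1) * (m - s)) / (k + 1)

lemma contDiff_smoothTrunc (m M : ℝ) (k : ℕ) : ContDiff ℝ (⊤ : ℕ∞) (smoothTrunc m M k) := by
  unfold smoothTrunc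
  exact ((contDiff_smoothPos.comp (by fun_prop)).div_const _).sub
    ((contDiff_smoothPos.comp (by fun_prop)).div_const _)

lemma smoothTrunc_eq_zero {m M s : ℝ} (k : ℕ) (h1 : m ≤ s) (h2 : s ≤ M) :
    smoothTrunc m M k s = 0 := by
  have hk : (0 : ℝ) < k + 1 := by positivity
  rw [smoothTrunc, smoothPos_of_nonpos, smoothPos_of_nonpos]
  · simp
  · nlinarith
  · nlinarith

lemma abs_smoothTrunc_sub_le (m M : ℝ) (k : ℕ) (s : ℝ) :
    |smoothTrunc m M k s - (max (s - M) 0 - max (m - s) 0)| ≤ 2 / (k + 1) := by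
  have hk : (0 : ℝ) < k + 1 := by positivity
  have key : ∀ x : ℝ, |smoothPos ((k + 1) * x) / (k + 1) - max x 0| ≤ 1 / (k + 1) := by
    intro x
    have := abs_smoothPos_sub_le ((k + 1) * x)
    rw [show max ((k + 1) * x) 0 = (k + 1) * max x 0 by
      rw [mul_max_of_nonneg _ _ hk.le, mul_zero]] at this
    rw [le_div_iff₀ hk]
    calc |smoothPos ((k + 1) * x) / (k + 1) - max x 0| * (k + 1)
        = |(smoothPos ((k + 1) * x) / (k + 1) - max x 0) * (k + 1)| := by
          rw [abs_mul, abs_of_pos hk]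
      _ = |smoothPos ((k + 1) * x) - (k + 1) * max x 0| := by
          congr 1
          field_simp
      _ ≤ 1 := this
  have h1 := abs_le.1 (key (s - M))
  have h2 := abs_le.1 (key (m - s))
  have h3 : (2 : ℝ) / (k + 1) = 1 / (k + 1) + 1 / (k + 1) := by ring
  rw [smoothTrunc, h3, abs_le]
  constructor <;> linarith [h1.1, h1.2, h2.1, h2.2]

lemma deriv_smoothTrunc (m M : ℝ) (k : ℕ) (s : ℝ) :
    deriv (smoothTrunc m M k) s =
      deriv smoothPos ((k + 1) * (s - M)) + deriv smoothPos ((k + 1) * (m - s)) := by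
  have hk : (k : ℝ) + 1 ≠ 0 := by positivity
  have hd : ∀ x, HasDerivAt smoothPos (deriv smoothPos x) x := fun x =>
    (contDiff_smoothPos.differentiable (by simp) x).hasDerivAt
  have h1 : HasDerivAt (fun s : ℝ => ((k : ℝ) + 1) * (s - M)) ((k + 1) * 1) s :=
    ((hasDerivAt_id s).sub_const M).const_mul _
  have h2 : HasDerivAt (fun s : ℝ => ((k : ℝ) + 1) * (m - s)) ((k + 1) * (-1)) s :=
    ((hasDerivAt_id s).const_sub m).const_mul _
  have := (((hd _).comp s h1).div_const ((k : ℝ) + 1)).sub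
    (((hd _).comp s h2).div_const ((k : ℝ) + 1))
  refine (HasDerivAt.deriv this).trans ?_
  field_simp
  ring

/-- The derivative of the truncation away from the two truncation levels. -/
def truncSlope (m M s : ℝ) : ℝ := (Ioi M).indicator 1 s + (Iio m).indicator 1 s

lemma measurable_truncSlope (m M : ℝ) : Measurable (truncSlope m M) :=
  (measurable_one.indicator measurableSet_Ioi).add (measurable_one.indicator measurableSet_Iio)

lemma abs_truncSlope_le (m M s : ℝ) : |truncSlope m M s| ≤ 2 := by
  unfold truncSlope indicator
  split_ifs <;> norm_num

lemma tendsto_deriv_smoothPos {x : ℕ → ℝ} {y : ℝ} (hx : Tendsto x atTop (𝓝 y)) (hy : y ≠ 0) :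
    Tendsto (fun k : ℕ => deriv smoothPos ((k + 1) * x k)) atTop
      (𝓝 ((Ioi 0).indicator 1 y)) := by
  have hk : Tendsto (fun k : ℕ => (k : ℝ) + 1) atTop atTop :=
    tendsto_atTop_add_const_right _ _ tendsto_natCast_atTop_atTop
  refine tendsto_const_nhds.congr' ?_
  rcases hy.lt_or_gt with h | h
  · filter_upwards [(hk.atTop_mul_neg h hx).eventually_lt_atBot 0] with k hk
    rw [deriv_smoothPos_of_neg hk, indicator_of_notMem (by simpa using h.le)]
  · filter_upwards [(hk.atTop_mul_pos h hx).eventually_gt_atTop 1] with k hk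
    rw [deriv_smoothPos_of_one_lt hk, indicator_of_mem (by simpa using h), Pi.one_apply]

lemma tendsto_deriv_smoothTrunc {m M : ℝ} {x : ℕ → ℝ} {y : ℝ} (hx : Tendsto x atTop (𝓝 y))
    (hm : y ≠ m) (hM : y ≠ M) :
    Tendsto (fun k => deriv (smoothTrunc m M k) (x k)) atTop (𝓝 (truncSlope m M y)) := by
  simp_rw [deriv_smoothTrunc]
  have h1 := tendsto_deriv_smoothPos (hx.sub_const M) (sub_ne_zero.2 hM)
  have h2 := tendsto_deriv_smoothPos (hx.const_sub m) (sub_ne_zero.2 hm.symm)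
  convert h1.add h2 using 2
  simp [truncSlope, indicator]

lemma abs_trunc_sub_le (m M a b : ℝ) :
    |(max (a - M) 0 - max (m - a) 0) - (max (b - M) 0 - max (m - b) 0)| ≤ 2 * |a - b| := by
  have h1 := abs_max_sub_max_le_abs (a - M) (b - M) 0
  have h2 := abs_max_sub_max_le_abs (m - a) (m - b) 0
  rw [show a - M - (b - M) = a - b by ring] at h1
  rw [show m - a - (m - b) = -(a - b) by ring, abs_neg] at h2
  have := abs_sub (max (a - M) 0 - max (b - M) 0) (max (m - a) 0 - max (m - b) 0)
  rw [show (max (a - M) 0 - max (m - a) 0) - (max (b - M) 0 - max (m - b) 0) =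
    (max (a - M) 0 - max (b - M) 0) - (max (m - a) 0 - max (m - b) 0) by ring]
  linarith

end Truncation

section TruncationSobolev

variable {n : ℕ}

lemma gradient_comp {θ : ℝ → ℝ} {v : Euc n → ℝ} {x : Euc n} (hθ : DifferentiableAt ℝ θ (v x))
    (hv : DifferentiableAt ℝ v x) :
    gradient (θ ∘ v) x = deriv θ (v x) • gradient v x := by
  have := (hθ.hasDerivAt.comp_hasFDerivAt x hv.hasFDerivAt).fderiv
  simp [gradient, this]

lemma isWeakGradOn_of_tendsto {Ω : Set (Euc n)} {f : Euc n → ℝ}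
    {h : Euc n → Euc n} (hf : IntegrableOn f Ω) (hh : IntegrableOn h Ω) {φ : ℕ → Euc n → ℝ}
    (hφ : ∀ k, ContDiff ℝ (⊤ : ℕ∞) (φ k)) (hφc : ∀ k, HasCompactSupport (φ k))
    (hlim : Tendsto (fun k => ∫⁻ x in Ω, ‖φ k x - f x‖ₑ) atTop (𝓝 0))
    (hlim' : Tendsto (fun k => ∫⁻ x in Ω, ‖gradient (φ k) x - h x‖ₑ) atTop (𝓝 0)) :
    IsWeakGradOn Ω f h := by
  refine ⟨hf.locallyIntegrableOn,
    IntegrableOn.locallyIntegrableOn (f := fun x => ‖h x‖) hh.norm, fun ψ hψ hψc hψΩ i => ?_⟩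
  set e : Euc n := EuclideanSpace.single i 1
  have hcψ' : Continuous fun x => fderiv ℝ ψ x e := by
    have := hψ.continuous_fderiv (by simp)
    fun_prop
  have hcψ := hψ.continuous
  have hz : ∀ x ∉ Ω, ψ x = 0 := fun x hx => image_eq_zero_of_notMem_tsupport fun h => hx (hψΩ h)
  have hz' : ∀ x ∉ Ω, fderiv ℝ ψ x e = 0 := fun x hx => by
    rw [image_eq_zero_of_notMem_tsupport fun h => hx (hψΩ (tsupport_fderiv_subset ℝ h))]
    rfl
  obtain ⟨B, hB⟩ := hcψ.bounded_above_of_compact_support hψc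
  obtain ⟨B', hB'⟩ := hcψ'.bounded_above_of_compact_support (hψc.fderiv_apply (𝕜 := ℝ) e)
  have hgen : ∀ (a : ℕ → Euc n → ℝ) (b q : Euc n → ℝ) (C : ℝ), IntegrableOn b Ω →
      (∀ k, Continuous (a k)) → (∀ k, HasCompactSupport (a k)) → Continuous q →
      (∀ x, ‖q x‖ ≤ C) → Tendsto (fun k => ∫⁻ x in Ω, ‖a k x - b x‖ₑ) atTop (𝓝 0) →
      Tendsto (fun k => ∫ x in Ω, a k x * q x) atTop (𝓝 (∫ x in Ω, b x * q x)) := by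
    intro a b q C hb ha hac hq hqC hab
    refine tendsto_integral_of_L1 _
      (hb.mul_bdd hq.aestronglyMeasurable (ae_of_all _ hqC)).aestronglyMeasurable
      (Eventually.of_forall fun k => ?_) ?_
    · exact (((ha k).mul hq).integrable_of_hasCompactSupport (hac k).mul_right).integrableOn
    · refine tendsto_of_tendsto_of_tendsto_of_le_of_le tendsto_const_nhds
        (h := fun k => (∫⁻ x in Ω, ‖a k x - b x‖ₑ) * ENNReal.ofReal C) ?_
        (fun _ => zero_le) fun k => ?_
      · simpa using ENNReal.Tendsto.mul_const hab (Or.inr ENNReal.ofReal_ne_top)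
      · dsimp only
        rw [← lintegral_mul_const' _ _ ENNReal.ofReal_ne_top]
        refine lintegral_mono fun x => ?_
        rw [← sub_mul, enorm_mul]
        gcongr
        rw [← ofReal_norm]
        exact ENNReal.ofReal_le_ofReal (hqC x)
  have e1 := hgen φ f (fun x => fderiv ℝ ψ x e) B' hf (fun k => (hφ k).continuous) hφc hcψ' hB' hlim
  have e2 := hgen (fun k x => fderiv ℝ (φ k) x e) (fun x => h x i) ψ B
    ((EuclideanSpace.proj i : Euc n →L[ℝ] ℝ).integrable_comp hh)
    (fun k => by have := (hφ k).continuous_fderiv (by simp); fun_prop)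
    (fun k => (hφc k).fderiv_apply (𝕜 := ℝ) e) hcψ hB (by
      refine tendsto_of_tendsto_of_tendsto_of_le_of_le tendsto_const_nhds hlim'
        (fun _ => zero_le) fun k => lintegral_mono fun x => ?_
      rw [← gradient_apply, ← ofReal_norm, ← ofReal_norm]
      exact ENNReal.ofReal_le_ofReal (PiLp.norm_apply_le (gradient (φ k) x - h x) i))
  have hs : ∀ a : Euc n → ℝ, ∫ x in Ω, a x * fderiv ℝ ψ x e = ∫ x, a x * fderiv ℝ ψ x e :=
    fun a => setIntegral_eq_integral_of_forall_compl_eq_zero fun x hx => by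
      rw [hz' x hx, mul_zero]
  have hs' : ∀ a : Euc n → ℝ, ∫ x in Ω, a x * ψ x = ∫ x, a x * ψ x :=
    fun a => setIntegral_eq_integral_of_forall_compl_eq_zero fun x hx => by
      rw [hz x hx, mul_zero]
  rw [hs] at e1
  rw [hs'] at e2
  refine tendsto_nhds_unique e1 ?_
  convert e2.neg using 2 with k
  rw [hs, hs']
  have hcφ := (hφ k).continuous
  have hcφ' : Continuous fun x => fderiv ℝ (φ k) x e := by
    have := (hφ k).continuous_fderiv (by simp)
    fun_prop
  exact integral_mul_fderiv_eq_neg_fderiv_mul_of_integrable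
    ((hcφ'.mul hcψ).integrable_of_hasCompactSupport hψc.mul_left)
    ((hcφ.mul hcψ').integrable_of_hasCompactSupport (hφc k).mul_right)
    ((hcφ.mul hcψ).integrable_of_hasCompactSupport hψc.mul_left)
    (fun x _ => (hφ k).differentiable (by simp) x) (fun x _ => hψ.differentiable (by simp) x)

lemma cube_cutoff {c : Euc n} {ρ : ℝ} {w : Euc n → ℝ}
    (hw : ContDiff ℝ (⊤ : ℕ∞) w) {θ : ℝ → ℝ} (hθ : ContDiff ℝ (⊤ : ℕ∞) θ) {m M : ℝ}
    (hθ0 : ∀ s, m ≤ s → s ≤ M → θ s = 0)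
    (hb : ∀ x ∈ closedCube c ρ, ∀ i, |x i - c i| = ρ → m < w x ∧ w x < M) :
    ContDiff ℝ (⊤ : ℕ∞) ((cube c ρ).indicator (θ ∘ w)) ∧
      HasCompactSupport ((cube c ρ).indicator (θ ∘ w)) ∧
      tsupport ((cube c ρ).indicator (θ ∘ w)) ⊆ cube c ρ := by
  let Z : Set (Euc n) := closedCube c ρ ∩ {x | w x ≤ m ∨ M ≤ w x}
  have hZc : IsClosed Z := (isClosed_closedCube c ρ).inter
    ((isClosed_le hw.continuous continuous_const).union
      (isClosed_le continuous_const hw.continuous))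
  have hZcub : Z ⊆ cube c ρ := by
    rintro x ⟨hx, hx'⟩ i
    refine lt_of_le_of_ne (hx i) fun h => ?_
    have := hb x hx i h
    rcases hx' with h' | h' <;> linarith [this.1, this.2]
  have hzero : ∀ x ∉ Z, (cube c ρ).indicator (θ ∘ w) x = 0 := by
    intro x hx
    by_cases hxc : x ∈ cube c ρ
    · rw [indicator_of_mem hxc]
      have hx' : ¬ (w x ≤ m ∨ M ≤ w x) := fun h => hx ⟨cube_subset_closedCube c ρ hxc, h⟩
      push Not at hx'
      exact hθ0 _ hx'.1.le hx'.2.le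
    · exact indicator_of_notMem hxc _
  have hsupp : tsupport ((cube c ρ).indicator (θ ∘ w)) ⊆ Z :=
    closure_minimal (fun x hx => by_contra fun h => hx (hzero x h)) hZc
  refine ⟨contDiff_iff_contDiffAt.2 fun x => ?_,
    HasCompactSupport.of_support_subset_isCompact
      ((isCompact_closedCube c ρ).inter_right
        ((isClosed_le hw.continuous continuous_const).union
          (isClosed_le continuous_const hw.continuous)))
      (subset_closure.trans hsupp), hsupp.trans hZcub⟩
  by_cases hx : x ∈ Z
  · refine (hθ.comp hw).contDiffAt.congr_of_eventuallyEq ?_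
    filter_upwards [(isOpen_cube c ρ).mem_nhds (hZcub hx)] with y hy using indicator_of_mem hy _
  · refine contDiffAt_const (c := (0 : ℝ)) |>.congr_of_eventuallyEq ?_
    filter_upwards [hZc.isOpen_compl.mem_nhds hx] with y hy using hzero y hy

lemma tendsto_lintegral_smoothTrunc {α : Type*} [MeasurableSpace α] {μ : Measure α}
    [IsFiniteMeasure μ] {u : α → ℝ} {w : ℕ → α → ℝ}
    (h : Tendsto (fun k => ∫⁻ x, ‖w k x - u x‖ₑ ∂μ) atTop (𝓝 0)) (m M : ℝ) :
    Tendsto (fun k => ∫⁻ x, ‖smoothTrunc m M k (w k x) -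
      (max (u x - M) 0 - max (m - u x) 0)‖ₑ ∂μ) atTop (𝓝 0) := by
  have hk : Tendsto (fun k : ℕ => ENNReal.ofReal (2 / ((k : ℝ) + 1))) atTop (𝓝 0) := by
    rw [← ENNReal.ofReal_zero]
    refine ENNReal.tendsto_ofReal ?_
    have := (tendsto_one_div_add_atTop_nhds_zero_nat (𝕜 := ℝ)).const_mul 2
    simpa [div_eq_mul_inv] using this
  have hb : Tendsto (fun k : ℕ => ENNReal.ofReal (2 / ((k : ℝ) + 1)) * μ univ +
      2 * ∫⁻ x, ‖w k x - u x‖ₑ ∂μ) atTop (𝓝 0) := by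
    have h1 := ENNReal.Tendsto.mul_const hk (Or.inr (measure_ne_top μ univ))
    have h2 := ENNReal.Tendsto.const_mul h (Or.inr (by simp : (2 : ℝ≥0∞) ≠ ∞))
    simpa using h1.add h2
  refine tendsto_of_tendsto_of_tendsto_of_le_of_le tendsto_const_nhds hb (fun _ => zero_le)
    fun k => ?_
  dsimp only
  rw [← lintegral_const, ← lintegral_const_mul' _ _ (by simp),
    ← lintegral_add_left measurable_const]
  refine lintegral_mono fun x => ?_
  rw [← ofReal_norm, ← ofReal_norm, show (2 : ℝ≥0∞) = ENNReal.ofReal 2 by simp,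
    ← ENNReal.ofReal_mul zero_le_two, ← ENNReal.ofReal_add (by positivity) (by positivity)]
  refine ENNReal.ofReal_le_ofReal ?_
  have h1 := abs_smoothTrunc_sub_le m M k (w k x)
  have h2 := abs_trunc_sub_le m M (w k x) (u x)
  simp only [Real.norm_eq_abs]
  exact (abs_sub_le _ (max (w k x - M) 0 - max (m - w k x) 0) _).trans (add_le_add h1 h2)

lemma tendsto_lintegral_deriv_smoothTrunc {α E : Type*} [MeasurableSpace α] {μ : Measure α}
    [NormedAddCommGroup E] [NormedSpace ℝ E]
    {u : α → ℝ} {w : ℕ → α → ℝ} {g : α → E} {z : ℕ → α → E}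
    (hw : ∀ k, AEMeasurable (w k) μ) (hu : AEMeasurable u μ) (hg : Integrable g μ)
    (hae : ∀ᵐ x ∂μ, Tendsto (fun k => w k x) atTop (𝓝 (u x)))
    (h : Tendsto (fun k => ∫⁻ x, ‖z k x - g x‖ₑ ∂μ) atTop (𝓝 0)) {m M : ℝ}
    (hm : ∀ᵐ x ∂μ, u x ≠ m) (hM : ∀ᵐ x ∂μ, u x ≠ M) :
    Tendsto (fun k => ∫⁻ x, ‖deriv (smoothTrunc m M k) (w k x) • z k x -
      truncSlope m M (u x) • g x‖ₑ ∂μ) atTop (𝓝 0) := by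
  obtain ⟨B, hB⟩ := exists_deriv_smoothPos_bound
  have hB0 : 0 ≤ B := (abs_nonneg _).trans (hB 0)
  have hBd : ∀ k s, |deriv (smoothTrunc m M k) s| ≤ 2 * B := fun k s => by
    rw [deriv_smoothTrunc, two_mul]
    exact (abs_add_le _ _).trans (add_le_add (hB _) (hB _))
  have hmd : ∀ k, Measurable (deriv (smoothTrunc m M k)) := fun k => measurable_deriv _
  have hdom : Tendsto (fun k => ∫⁻ x, ‖deriv (smoothTrunc m M k) (w k x) -
      truncSlope m M (u x)‖ₑ * ‖g x‖ₑ ∂μ) atTop (𝓝 (∫⁻ _, 0 ∂μ)) := by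
    refine tendsto_lintegral_of_dominated_convergence'
      (fun x => ENNReal.ofReal (2 * B + 2) * ‖g x‖ₑ) (fun k => ?_) (fun k => ?_) ?_ ?_
    · exact ((((hmd k).comp_aemeasurable (hw k)).sub
        ((measurable_truncSlope m M).comp_aemeasurable hu)).enorm).mul
        hg.aestronglyMeasurable.enorm
    · refine ae_of_all _ fun x => ?_
      dsimp only
      gcongr
      rw [← ofReal_norm]
      refine ENNReal.ofReal_le_ofReal ?_
      rw [Real.norm_eq_abs]
      exact (abs_sub _ _).trans (add_le_add (hBd _ _) (abs_truncSlope_le _ _ _))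
    · rw [lintegral_const_mul' _ _ ENNReal.ofReal_ne_top]
      exact ENNReal.mul_ne_top ENNReal.ofReal_ne_top hg.hasFiniteIntegral.ne
    · filter_upwards [hae, hm, hM] with x hx h1 h2
      have h3 := tendsto_iff_norm_sub_tendsto_zero.1 (tendsto_deriv_smoothTrunc hx h1 h2)
      have h4 := ENNReal.tendsto_ofReal h3
      rw [ENNReal.ofReal_zero] at h4
      simp_rw [ofReal_norm] at h4
      simpa using ENNReal.Tendsto.mul_const h4 (Or.inr enorm_ne_top)
  have hz := ENNReal.Tendsto.const_mul h (Or.inr (ENNReal.ofReal_ne_top (r := 2 * B)))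
  rw [lintegral_zero] at hdom
  have hsum := hz.add hdom
  rw [mul_zero, add_zero] at hsum
  refine tendsto_of_tendsto_of_tendsto_of_le_of_le tendsto_const_nhds hsum (fun _ => zero_le)
    fun k => ?_
  dsimp only
  have hme : AEMeasurable (fun x => ‖deriv (smoothTrunc m M k) (w k x) -
      truncSlope m M (u x)‖ₑ * ‖g x‖ₑ) μ :=
    ((((hmd k).comp_aemeasurable (hw k)).sub
        ((measurable_truncSlope m M).comp_aemeasurable hu)).enorm).mul
        hg.aestronglyMeasurable.enorm
  rw [← lintegral_const_mul' _ _ ENNReal.ofReal_ne_top, ← lintegral_add_right' _ hme]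
  refine lintegral_mono fun x => ?_
  calc _ = ‖deriv (smoothTrunc m M k) (w k x) • (z k x - g x) +
        (deriv (smoothTrunc m M k) (w k x) - truncSlope m M (u x)) • g x‖ₑ := by
        congr 1
        rw [smul_sub, sub_smul]; abel
    _ ≤ _ := enorm_add_le _ _
    _ ≤ _ := by
      rw [enorm_smul, enorm_smul]
      gcongr
      rw [← ofReal_norm]
      exact ENNReal.ofReal_le_ofReal (hBd _ _)

lemma memW110_trunc {c : Euc n} {ρ : ℝ} {u : Euc n → ℝ} {g : Euc n → Euc n}
    (hu : IntegrableOn u (cube c ρ)) (hg : IntegrableOn g (cube c ρ)) {w : ℕ → Euc n → ℝ}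
    (hw : ∀ k, ContDiff ℝ (⊤ : ℕ∞) (w k))
    (hae : ∀ᵐ x ∂volume.restrict (cube c ρ), Tendsto (fun k => w k x) atTop (𝓝 (u x)))
    (h0 : Tendsto (fun k => ∫⁻ x in cube c ρ, ‖w k x - u x‖ₑ) atTop (𝓝 0))
    (h1 : Tendsto (fun k => ∫⁻ x in cube c ρ, ‖gradient (w k) x - g x‖ₑ) atTop (𝓝 0))
    {m M : ℝ}
    (hb : ∀ k, ∀ x ∈ closedCube c ρ, ∀ i, |x i - c i| = ρ → m < w k x ∧ w k x < M)
    (hm : ∀ᵐ x ∂volume.restrict (cube c ρ), u x ≠ m)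
    (hM : ∀ᵐ x ∂volume.restrict (cube c ρ), u x ≠ M) :
    MemW110 (cube c ρ) (fun x => max (u x - M) 0 - max (m - u x) 0) := by
  have hfin : volume (cube c ρ) < ∞ :=
    (measure_mono (cube_subset_closedCube c ρ)).trans_lt (isCompact_closedCube c ρ).measure_lt_top
  have : IsFiniteMeasure (volume.restrict (cube c ρ)) := ⟨by simpa using hfin⟩
  have hQm := (isOpen_cube c ρ).measurableSet
  let φ : ℕ → Euc n → ℝ := fun k => (cube c ρ).indicator (smoothTrunc m M k ∘ w k)
  have hφ := fun k => cube_cutoff (hw k) (contDiff_smoothTrunc m M k)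
    (fun s => smoothTrunc_eq_zero k) (hb k)
  have hval : ∀ k, ∀ x ∈ cube c ρ, φ k x = smoothTrunc m M k (w k x) :=
    fun k x hx => indicator_of_mem hx _
  have hgrad : ∀ k, ∀ x ∈ cube c ρ,
      gradient (φ k) x = deriv (smoothTrunc m M k) (w k x) • gradient (w k) x := by
    intro k x hx
    have he : φ k =ᶠ[𝓝 x] smoothTrunc m M k ∘ w k := by
      filter_upwards [(isOpen_cube c ρ).mem_nhds hx] with y hy using indicator_of_mem hy _
    rw [← gradient_comp ((contDiff_smoothTrunc m M k).differentiable (by simp) _)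
      ((hw k).differentiable (by simp) x), gradient, gradient, he.fderiv_eq]
  let h : Euc n → Euc n := fun x => truncSlope m M (u x) • g x
  have hum := hu.aestronglyMeasurable.aemeasurable
  have l0 : Tendsto (fun k => ∫⁻ x in cube c ρ, ‖φ k x - (max (u x - M) 0 - max (m - u x) 0)‖ₑ)
      atTop (𝓝 0) := by
    refine (tendsto_lintegral_smoothTrunc h0 m M).congr fun k => ?_
    exact setLIntegral_congr_fun hQm fun x hx => by rw [hval k x hx]
  have l1 : Tendsto (fun k => ∫⁻ x in cube c ρ, ‖gradient (φ k) x - h x‖ₑ) atTop (𝓝 0) := by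
    refine (tendsto_lintegral_deriv_smoothTrunc (fun k => (hw k).continuous.aemeasurable)
      hum hg hae h1 hm hM).congr fun k => ?_
    exact setLIntegral_congr_fun hQm fun x hx => by rw [hgrad k x hx]
  have hfi : IntegrableOn (fun x => max (u x - M) 0 - max (m - u x) 0) (cube c ρ) :=
    ((hu.sub (integrable_const M)).pos_part).sub (((integrable_const m).sub hu).pos_part)
  have hhi : IntegrableOn h (cube c ρ) := by
    refine Integrable.bdd_smul (φ := fun x => truncSlope m M (u x)) hg 2 ?_
      (ae_of_all _ fun x => ?_)
    · exact ((measurable_truncSlope m M).comp_aemeasurable hum).aestronglyMeasurable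
    · rw [Real.norm_eq_abs]; exact abs_truncSlope_le m M _
  refine ⟨h, isWeakGradOn_of_tendsto hfi hhi (fun k => (hφ k).1)
    (fun k => (hφ k).2.1) l0 l1, φ, hφ, ?_⟩
  refine tendsto_zero_iff_enorm_tendsto_zero.2 ?_
  have hsum := l0.add l1
  rw [add_zero] at hsum
  refine tendsto_of_tendsto_of_tendsto_of_le_of_le tendsto_const_nhds hsum (fun _ => zero_le)
    fun k => ?_
  refine (enorm_integral_le_lintegral_enorm _).trans ?_
  have hme : AEMeasurable (fun x => ‖φ k x - (max (u x - M) 0 - max (m - u x) 0)‖ₑ)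
      (volume.restrict (cube c ρ)) :=
    (((hφ k).1.continuous.aestronglyMeasurable).sub hfi.aestronglyMeasurable).enorm
  dsimp only
  rw [← lintegral_add_left' hme]
  refine lintegral_mono fun x => ?_
  refine (enorm_add_le _ _).trans (le_of_eq ?_)
  rw [enorm_norm, Real.enorm_abs]

end TruncationSobolev

section CubeBound

lemma exists_slack {a b c J V X : ℝ≥0∞} (ha0 : a ≠ 0) (ha : a ≠ ∞) (hc0 : c ≠ 0) (hc : c ≠ ∞)
    (hX : X ≠ ∞) (hV : V ≠ ∞) (h : a * (J / c + b) < X) :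
    ∃ S : ℝ≥0∞, S ≠ ∞ ∧ a * (S + b) ≤ X ∧ ∃ δ : ℝ, 0 < δ ∧ J + ENNReal.ofReal δ * V < S * c := by
  have hXa : X / a ≠ ∞ := ENNReal.div_ne_top hX ha0
  have h1 : J / c + b < X / a := by
    rw [ENNReal.lt_div_iff_mul_lt (Or.inl ha0) (Or.inl ha), mul_comm]; exact h
  have hb : b ≤ X / a := le_add_self.trans h1.le
  have h2 : J / c < X / a - b := lt_tsub_iff_right.2 h1
  refine ⟨X / a - b, (tsub_le_self.trans_lt hXa.lt_top).ne, ?_, ?_⟩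
  · rw [tsub_add_cancel_of_le hb, ENNReal.mul_div_cancel ha0 ha]
  · have h3 : J < (X / a - b) * c := by
      rwa [ENNReal.div_lt_iff (Or.inl hc0) (Or.inl hc)] at h2
    have hlim : Tendsto (fun δ : ℝ => J + ENNReal.ofReal δ * V) (𝓝[>] 0) (𝓝 J) := by
      have h4 : Tendsto ENNReal.ofReal (𝓝[>] 0) (𝓝 (ENNReal.ofReal 0)) :=
        (ENNReal.continuous_ofReal.tendsto 0).mono_left nhdsWithin_le_nhds
      have := (ENNReal.Tendsto.mul_const h4 (Or.inr hV)).const_add J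
      simpa using this
    obtain ⟨δ, hδ, hδ0⟩ := ((hlim.eventually_lt_const h3).and self_mem_nhdsWithin).exists
    exact ⟨δ, hδ0, hδ⟩

lemma exists_ae_ne {α : Type*} [MeasurableSpace α] {μ : Measure α} [SFinite μ] {u : α → ℝ}
    (hu : AEMeasurable u μ) {a b : ℝ} (hab : a < b) : ∃ m ∈ Ioo a b, ∀ᵐ x ∂μ, u x ≠ m := by
  obtain ⟨m, hm, hm'⟩ := (Measure.countable_meas_level_set_pos₀ hu.nullMeasurable).dense_compl ℝ
    |>.exists_between hab
  refine ⟨m, hm', ?_⟩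
  have : ¬ 0 < μ {x | u x = m} := hm
  simpa [ae_iff] using this

lemma exists_bounds_cube {k : ℕ} {Ω : Set (Euc (k + 2))} {u : Euc (k + 2) → ℝ}
    {g : Euc (k + 2) → Euc (k + 2)} (hug : IsWeakGradOn Ω u g) (hmono : WeaklyMonotone Ω u)
    {c : Euc (k + 2)} {R : ℝ} (hR : 0 < R) (hW : closedCube c (2 * R) ⊆ Ω)
    (hg : IntegrableOn g (closedCube c (2 * R))) {F : Euc (k + 2) → ℝ≥0∞} (hF : Measurable F)
    {G : ℝ → ℝ≥0∞}
    (hFG : ∀ᵐ z ∂volume.restrict (closedCube c (2 * R)), ∀ t : ℝ, 0 ≤ t →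
      ENNReal.ofReal (t * ‖g z‖) ≤ F z + G t) {t : ℝ} (ht : 0 < t) {ω : ℝ} (hω : 0 < ω)
    (hmain : ENNReal.ofReal (4 * R * ((k + 2 : ℕ) : ℝ)) *
      (2 * ((k + 2 : ℕ) : ℝ≥0∞) * (∫⁻ z in closedCube c (2 * R), F z) / ENNReal.ofReal (R / 2) +
        ENNReal.ofReal ((2 * R) ^ (k + 1)) * kernelMean k G t) <
      ENNReal.ofReal (t * (2 * R) ^ (k + 1) * ω)) :
    ∃ m M : ℝ, M - m ≤ 8 * ω ∧ ∀ᵐ x ∂volume.restrict (cube c (R / 2)), m ≤ u x ∧ u x ≤ M := by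
  obtain ⟨v, Fs, hv, hFs, hFsF, hvu, hvF, hae, h0, h1⟩ := exists_smooth_approx hug hR hW hg hF hFG
  have hui : IntegrableOn u (closedCube c (2 * R)) :=
    hug.1.integrableOn_compact_subset hW (isCompact_closedCube c _)
  set V := ∫⁻ x in closedCube c (2 * R), ‖u x‖ₑ
  have hV : V ≠ ∞ := hui.hasFiniteIntegral.ne
  have hN : (0 : ℝ) < ((k + 2 : ℕ) : ℝ) := by positivity
  obtain ⟨S, hS, hSω, δ, hδ, hQ⟩ := exists_slack (V := 2 * ((k + 2 : ℕ) : ℝ≥0∞) * V)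
    (by simpa using by positivity) ENNReal.ofReal_ne_top (by simpa using by positivity)
    ENNReal.ofReal_ne_top ENNReal.ofReal_ne_top
    (ENNReal.mul_ne_top (ENNReal.mul_ne_top (by simp) (by simp)) hV) hmain
  obtain ⟨ρ, hρ, p, φ, hφ, hbd⟩ := exists_good_box hR ht hv
    (E := fun j x => Fs j x + ENNReal.ofReal δ * ‖v j x‖ₑ)
    (fun j => (hFs j).add ((hv j).continuous.measurable.enorm.const_mul _))
    (Q := (∫⁻ z in closedCube c (2 * R), F z) + ENNReal.ofReal δ * V)
    (fun j => by
      rw [lintegral_add_left (hFs j), lintegral_const_mul' _ _ ENNReal.ofReal_ne_top]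
      exact add_le_add (hFsF j) (mul_le_mul_right (hvu j) _))
    (fun j x hx τ hτ => (hvF j x hx τ hτ).trans (by gcongr; exact le_self_add))
    hδ (fun j x => le_add_self)
    (by rw [mul_add, show ∀ a b d : ℝ≥0∞, a * (b * d) = b * (a * d) by intros; ring]; exact hQ)
    hS hω hSω
  have hsub : cube c ρ ⊆ closedCube c R :=
    (cube_subset_closedCube c ρ).trans (closedCube_subset_closedCube c hρ.2.le)
  have hsub2 : closedCube c ρ ⊆ closedCube c (2 * R) :=
    closedCube_subset_closedCube c (by linarith [hρ.2])
  have hsub3 : cube c ρ ⊆ closedCube c (2 * R) := (cube_subset_closedCube c ρ).trans hsub2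
  have hum : AEMeasurable u (volume.restrict (cube c ρ)) :=
    (hui.mono_set hsub3).aestronglyMeasurable.aemeasurable
  obtain ⟨m, hm, hmu⟩ := exists_ae_ne hum (show p - 4 * ω < p - 3 * ω by linarith)
  obtain ⟨M, hM, hMu⟩ := exists_ae_ne hum (show p + 3 * ω < p + 4 * ω by linarith)
  have hle0 : ∀ {f : ℕ → Euc (k + 2) → ℝ≥0∞},
      Tendsto (fun j => ∫⁻ x in closedCube c R, f j x) atTop (𝓝 0) →
      Tendsto (fun j => ∫⁻ x in cube c ρ, f (φ j) x) atTop (𝓝 0) := fun h =>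
    tendsto_of_tendsto_of_tendsto_of_le_of_le tendsto_const_nhds (h.comp hφ.tendsto_atTop)
      (fun _ => zero_le) fun j => lintegral_mono_set hsub
  have hmem := memW110_trunc (c := c) (ρ := ρ) (hui.mono_set hsub3) (hg.mono_set hsub3)
    (w := fun j => v (φ j)) (fun j => hv (φ j))
    ((ae_restrict_of_ae_restrict_of_subset hsub hae).mono fun x hx => hx.comp hφ.tendsto_atTop)
    (hle0 h0) (hle0 h1) (m := m) (M := M)
    (fun j x hx i hi => by
      have := abs_le.1 (hbd j x hx i hi)
      exact ⟨by linarith [hm.2, this.1], by linarith [hM.1, this.2]⟩) hmu hMu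
  have hcl := closure_cube_subset c ρ
  have hres := hmono (cube c ρ) (isOpen_cube c ρ)
    ((isCompact_closedCube c ρ).of_isClosed_subset isClosed_closure hcl)
    (hcl.trans (hsub2.trans hW)) m M (by linarith [hm.2, hM.1]) hmem
  exact ⟨m, M, by linarith [hm.1, hM.2],
    ae_restrict_of_ae_restrict_of_subset (cube_subset_cube c hρ.1.le) hres⟩

end CubeBound

section Kernel

/-- The function whose Young conjugate is `A_{n-1}` when `G = Ã`. -/
def shiftedTail (n : ℕ) (G : ℝ → ℝ≥0∞) (t : ℝ) : ℝ≥0∞ :=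
  ENNReal.ofReal (t ^ youngExp n) * ∫⁻ r in Ioi t, G r / ENNReal.ofReal (r ^ (1 + youngExp n))

lemma kernelMean_zero (G : ℝ → ℝ≥0∞) (t : ℝ) : kernelMean 0 G t = 2 * G t := by
  simp [kernelMean, Real.volume_pi_closedBall, mul_comm]

lemma youngExp_add_two (k : ℕ) : youngExp (k + 2) = (k + 1) / k := by
  rw [youngExp]; push_cast; congr 1 <;> ring

lemma youngExp_pos {k : ℕ} (hk : 1 ≤ k) : 0 < youngExp (k + 2) := by
  have : (0 : ℝ) < k := by exact_mod_cast hk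
  rw [youngExp_add_two]; positivity

lemma rpow_youngExp {k : ℕ} (hk : 1 ≤ k) {x : ℝ} (hx : 0 ≤ x) :
    (x ^ k) ^ youngExp (k + 2) = x ^ (k + 1) := by
  have hk0 : (k : ℝ) ≠ 0 := by positivity
  rw [← Real.rpow_natCast x k, ← Real.rpow_mul hx, ← Real.rpow_natCast x (k + 1),
    youngExp_add_two, mul_div_cancel₀ _ hk0, Nat.cast_add_one]

lemma le_mul_lintegral_dyadic {k : ℕ} (hk : 1 ≤ k) {G : ℝ → ℝ≥0∞} (hG : Monotone G) {τ : ℝ}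
    (hτ : 0 < τ) :
    G τ ≤ ENNReal.ofReal (2 ^ (2 * k + 1) * τ ^ youngExp (k + 2)) *
      ∫⁻ r in Ioo τ (2 ^ k * τ), G r / ENNReal.ofReal (r ^ (1 + youngExp (k + 2))) := by
  set p := youngExp (k + 2) with hp
  have hp0 : 0 < p := youngExp_pos hk
  have h2 : (2 : ℝ) ≤ 2 ^ k := by
    calc (2 : ℝ) = 2 ^ 1 := (pow_one 2).symm
      _ ≤ 2 ^ k := pow_le_pow_right₀ one_le_two hk
  have hpow : ((2 : ℝ) ^ k * τ) ^ (1 + p) = 2 ^ (2 * k + 1) * τ ^ p * τ := by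
    rw [Real.mul_rpow (by positivity) hτ.le, Real.rpow_add (by positivity), Real.rpow_add hτ,
      rpow_youngExp hk zero_le_two, Real.rpow_one, Real.rpow_one]
    ring
  have hlow : ∫⁻ r in Ioo τ (2 ^ k * τ), G τ / ENNReal.ofReal (2 ^ (2 * k + 1) * τ ^ p * τ) ≤
      ∫⁻ r in Ioo τ (2 ^ k * τ), G r / ENNReal.ofReal (r ^ (1 + p)) := by
    refine setLIntegral_mono' measurableSet_Ioo fun r hr => ?_
    rw [← hpow]
    have h0 : 0 ≤ r := hτ.le.trans hr.1.le
    gcongr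
    · exact hG hr.1.le
    · exact hr.2.le
  rw [setLIntegral_const, Real.volume_Ioo] at hlow
  calc G τ = ENNReal.ofReal (2 ^ (2 * k + 1) * τ ^ p) *
        (G τ / ENNReal.ofReal (2 ^ (2 * k + 1) * τ ^ p * τ) * ENNReal.ofReal τ) := by
        have h1 : ENNReal.ofReal (2 ^ (2 * k + 1) * τ ^ p * τ) ≠ 0 := by
          simp only [ne_eq, ENNReal.ofReal_eq_zero, not_le]; positivity
        calc G τ = ENNReal.ofReal (2 ^ (2 * k + 1) * τ ^ p * τ) *
              (G τ / ENNReal.ofReal (2 ^ (2 * k + 1) * τ ^ p * τ)) :=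
              (ENNReal.mul_div_cancel h1 ENNReal.ofReal_ne_top).symm
          _ = _ := by
              nth_rewrite 1 [ENNReal.ofReal_mul (by positivity)]
              ring
    _ ≤ ENNReal.ofReal (2 ^ (2 * k + 1) * τ ^ p) *
        (G τ / ENNReal.ofReal (2 ^ (2 * k + 1) * τ ^ p * τ) *
          ENNReal.ofReal (2 ^ k * τ - τ)) := by
        gcongr
        nlinarith
    _ ≤ _ := by gcongr

lemma kernelMean_le_shiftedTail {k : ℕ} (hk : 1 ≤ k) {G : ℝ → ℝ≥0∞} (hG : Monotone G) {t : ℝ}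
    (ht : 0 < t) :
    kernelMean k G t ≤ ENNReal.ofReal (2 ^ (2 * k + 1) * 4 ^ (k + 1)) *
      shiftedTail (k + 2) G t := by
  set p := youngExp (k + 2) with hp
  let W : ℝ → ℝ≥0∞ := fun r => G r / ENNReal.ofReal (r ^ (1 + p))
  have hW : Measurable W := hG.measurable.div (by fun_prop)
  let τ : (Fin (k + 1) → ℝ) → ℝ := fun x => t * (1 / ‖x‖) ^ k
  have hτm : Measurable τ := by fun_prop
  let C : ℝ := 2 ^ (2 * k + 1) * t ^ p
  have hC : 0 ≤ C := by positivity
  let Φ : (Fin (k + 1) → ℝ) → ℝ → ℝ≥0∞ := fun x r =>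
    {q : (Fin (k + 1) → ℝ) × ℝ | τ q.1 < q.2 ∧ q.2 < 2 ^ k * τ q.1}.indicator
      (fun q => ENNReal.ofReal (C * (1 / ‖q.1‖) ^ (k + 1)) * W q.2) (x, r)
  have hΦ : Measurable (Function.uncurry Φ) := by
    refine Measurable.indicator ?_ ?_
    · exact (by fun_prop : Measurable fun q : (Fin (k + 1) → ℝ) × ℝ =>
        ENNReal.ofReal (C * (1 / ‖q.1‖) ^ (k + 1))).mul (hW.comp measurable_snd)
    · exact (measurableSet_lt (by fun_prop) measurable_snd).inter
        (measurableSet_lt measurable_snd (by fun_prop))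
  have hne : ∀ᵐ x : Fin (k + 1) → ℝ ∂volume.restrict (closedBall 0 1), x ≠ 0 :=
    ae_restrict_of_ae (by simp [ae_iff])
  calc kernelMean k G t ≤ ∫⁻ x in closedBall (0 : Fin (k + 1) → ℝ) 1, ∫⁻ r in Ioi t, Φ x r := by
        refine lintegral_mono_ae ?_
        filter_upwards [hne, ae_restrict_mem measurableSet_closedBall] with x hx hx1
        have hx0 : 0 < ‖x‖ := norm_pos_iff.2 hx
        have hx1 : ‖x‖ ≤ 1 := mem_closedBall_zero_iff.1 hx1
        have hτ0 : 0 < τ x := by positivity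
        have htτ : t ≤ τ x := by
          refine le_mul_of_one_le_right ht.le (one_le_pow₀ ?_)
          rwa [one_le_div hx0]
        refine (le_mul_lintegral_dyadic hk hG hτ0).trans (le_of_eq ?_)
        rw [← lintegral_const_mul' _ _ ENNReal.ofReal_ne_top]
        have hset : Ioo (τ x) (2 ^ k * τ x) ⊆ Ioi t := fun r hr => htτ.trans_lt hr.1
        have hCτ : 2 ^ (2 * k + 1) * τ x ^ p = C * (1 / ‖x‖) ^ (k + 1) := by
          simp only [τ, C]
          rw [Real.mul_rpow ht.le (by positivity), rpow_youngExp hk (by positivity)]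
          ring
        have hfun : ∀ r, Φ x r = (Ioo (τ x) (2 ^ k * τ x)).indicator (fun r =>
            ENNReal.ofReal (2 ^ (2 * k + 1) * τ x ^ p) * W r) r := fun r => by
          rw [hCτ]; rfl
        simp_rw [hfun]
        rw [lintegral_indicator measurableSet_Ioo, Measure.restrict_restrict measurableSet_Ioo,
          inter_eq_left.2 hset]
    _ = ∫⁻ r in Ioi t, ∫⁻ x in closedBall (0 : Fin (k + 1) → ℝ) 1, Φ x r :=
        lintegral_lintegral_swap hΦ.aemeasurable
    _ ≤ ∫⁻ r in Ioi t, ENNReal.ofReal (C * 4 ^ (k + 1)) * W r := by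
        refine setLIntegral_mono' measurableSet_Ioi fun r hr => ?_
        have hr0 : 0 < r := ht.trans hr
        let s : ℝ := (t / r) ^ ((k : ℝ)⁻¹)
        have hs0 : 0 < s := by positivity
        have hsk : s ^ k = t / r := Real.rpow_inv_natCast_pow (by positivity) (by omega)
        calc ∫⁻ x in closedBall (0 : Fin (k + 1) → ℝ) 1, Φ x r
            ≤ ∫⁻ x, (closedBall (0 : Fin (k + 1) → ℝ) (2 * s)).indicator (fun _ =>
              ENNReal.ofReal (C * (1 / s) ^ (k + 1)) * W r) x := by
              refine (lintegral_mono_ae ?_).trans (setLIntegral_le_lintegral (closedBall 0 1) _)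
              filter_upwards [hne] with x hx
              have hx0 : 0 < ‖x‖ := norm_pos_iff.2 hx
              by_cases hmem : τ x < r ∧ r < 2 ^ k * τ x
              · have h1 : s < ‖x‖ := by
                  refine lt_of_pow_lt_pow_left₀ k hx0.le ?_
                  rw [hsk, div_lt_iff₀ hr0]
                  have := hmem.1
                  simp only [τ, one_div, inv_pow] at this
                  rwa [← div_eq_mul_inv, div_lt_iff₀ (by positivity), mul_comm] at this
                have h2 : ‖x‖ < 2 * s := by
                  refine lt_of_pow_lt_pow_left₀ k (by positivity) ?_
                  rw [mul_pow, hsk, ← mul_div_assoc, lt_div_iff₀ hr0]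
                  have := hmem.2
                  simp only [τ, one_div, inv_pow] at this
                  rwa [← div_eq_mul_inv, ← mul_div_assoc, lt_div_iff₀ (by positivity),
                    mul_comm] at this
                simp only [Φ]
                rw [indicator_of_mem (show (x, r) ∈ _ from hmem),
                  indicator_of_mem (mem_closedBall_zero_iff.2 h2.le)]
                dsimp only
                gcongr
              · simp only [Φ]
                rw [indicator_of_notMem (show (x, r) ∉ _ from hmem)]
                exact zero_le
          _ = ENNReal.ofReal (C * 4 ^ (k + 1)) * W r := by
              rw [lintegral_indicator measurableSet_closedBall, setLIntegral_const,
                volume_closedBall_pi _ (by positivity), mul_right_comm,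
                ← ENNReal.ofReal_mul (by positivity)]
              congr 2
              rw [mul_assoc, ← mul_pow]
              congr 2
              field_simp
              norm_num
    _ = _ := by
        rw [lintegral_const_mul' _ _ ENNReal.ofReal_ne_top, shiftedTail, ← mul_assoc,
          ← ENNReal.ofReal_mul (by positivity)]
        congr 2
        simp only [C]
        ring

end Kernel

section Young

lemma IsYoung.map_mul_le {A : ℝ → ℝ≥0∞} (hA : IsYoung A) {l x : ℝ} (hl : 0 ≤ l) (hl1 : l ≤ 1)
    (hx : 0 ≤ x) : A (l * x) ≤ ENNReal.ofReal l * A x := by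
  simpa [hA.1] using hA.2.1 hx le_rfl hl hl1

lemma IsYoung.monotoneOn {A : ℝ → ℝ≥0∞} (hA : IsYoung A) : MonotoneOn A (Ici 0) := by
  intro x hx y hy hxy
  rcases eq_or_lt_of_le (show (0 : ℝ) ≤ y from hy) with rfl | hy0
  · rw [le_antisymm hxy hx]
  · have h := hA.map_mul_le (div_nonneg hx hy0.le) ((div_le_one hy0).2 hxy) hy0.le
    rw [div_mul_cancel₀ _ hy0.ne'] at h
    refine h.trans (mul_le_of_le_one_left' ?_)
    exact ENNReal.ofReal_le_one.2 ((div_le_one hy0).2 hxy)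

lemma IsYoung.monotone_max {A : ℝ → ℝ≥0∞} (hA : IsYoung A) :
    Monotone fun s => A (max s 0) := fun _ _ h =>
  hA.monotoneOn (mem_Ici.2 (le_max_right _ _)) (mem_Ici.2 (le_max_right _ _)) (max_le_max_right _ h)

/-- Above `s`, a Young function lies above the chord through `(s, A s)`. -/
lemma IsYoung.mul_div_le {A : ℝ → ℝ≥0∞} (hA : IsYoung A) {s σ a : ℝ} (hs : 0 < s) (hσ : s ≤ σ)
    (ha : ENNReal.ofReal a ≤ A s) : ENNReal.ofReal (σ * (a / s)) ≤ A σ := by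
  have hσ0 : 0 < σ := hs.trans_le hσ
  have h := hA.map_mul_le (div_nonneg hs.le hσ0.le) ((div_le_one hσ0).2 hσ) hσ0.le
  rw [div_mul_cancel₀ _ hσ0.ne'] at h
  calc ENNReal.ofReal (σ * (a / s)) = ENNReal.ofReal (σ / s) * ENNReal.ofReal a := by
        rw [← ENNReal.ofReal_mul (by positivity)]; congr 1; ring
    _ ≤ ENNReal.ofReal (σ / s) * (ENNReal.ofReal (s / σ) * A σ) := by
        gcongr; exact ha.trans h
    _ = A σ := by
        rw [← mul_assoc, ← ENNReal.ofReal_mul (by positivity), div_mul_div_cancel₀ hs.ne',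
          div_self hσ0.ne', ENNReal.ofReal_one, one_mul]

lemma monotone_youngConj (A : ℝ → ℝ≥0∞) : Monotone (youngConj A) := fun _ _ h =>
  iSup_mono fun s => tsub_le_tsub_right
    (ENNReal.ofReal_le_ofReal (mul_le_mul_of_nonneg_left h s.2)) _

lemma ofReal_mul_le_add_youngConj (A : ℝ → ℝ≥0∞) {s : ℝ} (hs : 0 ≤ s) (t : ℝ) :
    ENNReal.ofReal (s * t) ≤ A s + youngConj A t :=
  tsub_le_iff_left.1 (le_iSup (fun s : Ici (0 : ℝ) => ENNReal.ofReal ((s : ℝ) * t) - A s) ⟨s, hs⟩)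

lemma youngConj_le_of_le {A : ℝ → ℝ≥0∞} (hA : IsYoung A) {s a : ℝ} (hs : 0 < s) (ha : 0 ≤ a)
    (has : ENNReal.ofReal a ≤ A s) : youngConj A (a / s) ≤ ENNReal.ofReal a := by
  refine iSup_le fun ⟨σ, hσ⟩ => ?_
  rcases le_total s σ with h | h
  · rw [tsub_eq_zero_of_le (hA.mul_div_le hs h has)]; exact zero_le
  · refine tsub_le_self.trans (ENNReal.ofReal_le_ofReal ?_)
    calc σ * (a / s) ≤ s * (a / s) := by gcongr
      _ = a := mul_div_cancel₀ _ hs.ne'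

lemma youngShifted_zero {A : ℝ → ℝ≥0∞} (hA : IsYoung A) (n : ℕ) : youngShifted n A 0 = 0 := by
  rw [youngShifted]
  split_ifs
  · exact hA.1
  · simp [youngConj]

/-- Scale at which the kernel average of the conjugate is controlled by `A_{n-1}`. -/
lemma exists_scale (k : ℕ) {A : ℝ → ℝ≥0∞} (hA : IsYoung A) {s : ℝ} (hs : 0 < s) {τ : ℝ≥0∞}
    (hτ : τ < youngShifted (k + 2) A s) :
    ∃ t : ℝ, 0 < t ∧ τ + kernelMean k (youngConj A) t ≤
      ENNReal.ofReal ((3 + 2 ^ (2 * k + 1) * 4 ^ (k + 1)) * (s * t)) := by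
  rcases Nat.eq_zero_or_pos k with rfl | hk
  · rw [youngShifted, if_pos rfl] at hτ
    have hτt : τ ≠ ⊤ := hτ.ne_top
    let b : ℝ≥0∞ := min (A s) (τ + 1)
    have hbt : b ≠ ⊤ := ne_top_of_le_ne_top (by finiteness) (min_le_right _ _)
    have hτb : τ < b := lt_min hτ (ENNReal.lt_add_right hτt one_ne_zero)
    have hb0 : 0 < b.toReal := ENNReal.toReal_pos (bot_le.trans_lt hτb).ne' hbt
    refine ⟨b.toReal / s, by positivity, ?_⟩
    have hY := youngConj_le_of_le hA hs hb0.le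
      (by rw [ENNReal.ofReal_toReal hbt]; exact min_le_left _ _)
    rw [kernelMean_zero, mul_div_cancel₀ _ hs.ne']
    calc τ + 2 * youngConj A (b.toReal / s)
        ≤ ENNReal.ofReal b.toReal + 2 * ENNReal.ofReal b.toReal := by
          gcongr
          rw [ENNReal.ofReal_toReal hbt]; exact hτb.le
      _ = ENNReal.ofReal (3 * b.toReal) := by
          rw [ENNReal.ofReal_mul (by norm_num)]; norm_num; ring
      _ ≤ _ := by gcongr; norm_num
  · rw [youngShifted, if_neg (by omega)] at hτ
    obtain ⟨⟨t, ht0⟩, ht⟩ := lt_iSup_iff.1 hτ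
    have ht' : τ + shiftedTail (k + 2) (youngConj A) t ≤ ENNReal.ofReal (s * t) := by
      rw [mul_comm]; exact (lt_tsub_iff_right.1 ht).le
    have htpos : 0 < t := by
      rcases eq_or_lt_of_le (show (0 : ℝ) ≤ t from ht0) with rfl | h
      · simp at ht
      · exact h
    refine ⟨t, htpos, ?_⟩
    calc τ + kernelMean k (youngConj A) t
        ≤ τ + ENNReal.ofReal (2 ^ (2 * k + 1) * 4 ^ (k + 1)) *
          shiftedTail (k + 2) (youngConj A) t := by
          gcongr; exact kernelMean_le_shiftedTail hk (monotone_youngConj A) htpos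
      _ ≤ ENNReal.ofReal (3 + 2 ^ (2 * k + 1) * 4 ^ (k + 1)) * τ +
          ENNReal.ofReal (3 + 2 ^ (2 * k + 1) * 4 ^ (k + 1)) *
          shiftedTail (k + 2) (youngConj A) t := by
          gcongr
          · refine le_mul_of_one_le_left' (ENNReal.one_le_ofReal.2 ?_)
            have : (0 : ℝ) < 2 ^ (2 * k + 1) * 4 ^ (k + 1) := by positivity
            linarith
          · linarith
      _ ≤ _ := by
          rw [← mul_add, ENNReal.ofReal_mul (by positivity)]
          gcongr

end Young

section Tail

lemma lintegral_Ioi_div_rpow {k : ℕ} (hk : 1 ≤ k) {a : ℝ} (ha : 0 < a) :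
    ∫⁻ r in Ioi a, ENNReal.ofReal r / ENNReal.ofReal (r ^ (1 + youngExp (k + 2))) =
      ENNReal.ofReal (k * (1 / a) ^ (1 / (k : ℝ))) := by
  have hk0 : (0 : ℝ) < k := by exact_mod_cast hk
  have hlt : -1 - 1 / (k : ℝ) < -1 := by
    have : 0 < 1 / (k : ℝ) := by positivity
    linarith
  calc _ = ∫⁻ r in Ioi a, ENNReal.ofReal (r ^ (-1 - 1 / (k : ℝ))) := by
        refine setLIntegral_congr_fun measurableSet_Ioi fun r hr => ?_
        have hr0 : 0 < r := ha.trans hr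
        rw [← ENNReal.ofReal_div_of_pos (by positivity)]
        congr 1
        nth_rewrite 1 [← Real.rpow_one r]
        rw [← Real.rpow_sub hr0, youngExp_add_two]
        congr 1
        field_simp
        ring
    _ = ENNReal.ofReal (∫ r in Ioi a, r ^ (-1 - 1 / (k : ℝ))) := by
        rw [ofReal_integral_eq_lintegral_ofReal (integrableOn_Ioi_rpow_of_lt hlt ha)]
        filter_upwards [ae_restrict_mem measurableSet_Ioi] with r hr
        exact Real.rpow_nonneg (ha.trans hr).le _
    _ = _ := by
        rw [integral_Ioi_rpow_of_lt hlt ha]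
        congr 1
        have h1 : -1 - 1 / (k : ℝ) + 1 = -(1 / k) := by ring
        rw [h1, Real.rpow_neg ha.le, one_div a, Real.inv_rpow ha.le]
        field_simp

lemma youngConj_le_mul_volume {A : ℝ → ℝ≥0∞} (hA : IsYoung A) {r : ℝ} (hr : 0 < r) :
    youngConj A r ≤ ENNReal.ofReal r *
      volume.restrict (Ioi 0) {s | A (max s 0) < ENNReal.ofReal (r * s)} := by
  refine iSup_le fun ⟨s, hs⟩ => ?_
  dsimp only
  rcases le_or_gt (ENNReal.ofReal (s * r)) (A s) with h | h
  · rw [tsub_eq_zero_of_le h]; exact zero_le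
  · have hsub : Ioc 0 s ⊆ {σ | A (max σ 0) < ENNReal.ofReal (r * σ)} ∩ Ioi 0 := by
      intro σ hσ
      refine ⟨?_, hσ.1⟩
      have hs0 : 0 < s := hσ.1.trans_le hσ.2
      have h1 := hA.map_mul_le (div_nonneg hσ.1.le hs0.le) ((div_le_one hs0).2 hσ.2) hs0.le
      rw [div_mul_cancel₀ _ hs0.ne'] at h1
      have hp : 0 < σ / s := div_pos hσ.1 hs0
      show A (max σ 0) < _
      rw [max_eq_left hσ.1.le]
      calc A σ ≤ ENNReal.ofReal (σ / s) * A s := h1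
        _ < ENNReal.ofReal (σ / s) * ENNReal.ofReal (s * r) :=
            (ENNReal.mul_lt_mul_iff_right (by simpa using hp) ENNReal.ofReal_ne_top).2 h
        _ = ENNReal.ofReal (r * σ) := by
            rw [← ENNReal.ofReal_mul hp.le]; congr 1; field_simp
    calc ENNReal.ofReal (s * r) - A s ≤ ENNReal.ofReal (s * r) := tsub_le_self
      _ = ENNReal.ofReal r * volume (Ioc 0 s) := by
          rw [Real.volume_Ioc, sub_zero, ← ENNReal.ofReal_mul hr.le, mul_comm]
      _ ≤ _ := by
          rw [Measure.restrict_apply' measurableSet_Ioi]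
          exact mul_le_mul_right (measure_mono hsub) _

lemma lintegral_indicator_lt_le {k : ℕ} (hk : 1 ≤ k) (a : ℝ≥0∞) {s : ℝ} (hs : 0 < s)
    (lam : ℝ) :
    ∫⁻ r in Ioi lam, {r | a < ENNReal.ofReal (r * s)}.indicator
      (fun r => ENNReal.ofReal r / ENNReal.ofReal (r ^ (1 + youngExp (k + 2)))) r ≤
      ENNReal.ofReal k * (ENNReal.ofReal s / a) ^ (1 / (k : ℝ)) := by
  have hk0 : (0 : ℝ) < k := by exact_mod_cast hk
  have hk1 : 0 < 1 / (k : ℝ) := by positivity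
  rcases eq_or_ne a ⊤ with rfl | hat
  · simp
  rcases eq_or_ne a 0 with rfl | ha0
  · rw [ENNReal.div_zero (by simpa using hs), ENNReal.top_rpow_of_pos hk1,
      ENNReal.mul_top (ENNReal.ofReal_pos.2 hk0).ne']
    exact le_top
  have hb : 0 < a.toReal := ENNReal.toReal_pos ha0 hat
  calc _ ≤ ∫⁻ r, (Ioi (a.toReal / s)).indicator
        (fun r => ENNReal.ofReal r / ENNReal.ofReal (r ^ (1 + youngExp (k + 2)))) r := by
        refine (setLIntegral_le_lintegral _ _).trans (lintegral_mono fun r => ?_)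
        refine indicator_le_indicator_of_subset (fun r hr => ?_) (fun _ => zero_le) r
        have hr' : a < ENNReal.ofReal (r * s) := hr
        rw [← ENNReal.ofReal_toReal hat] at hr'
        rw [mem_Ioi, div_lt_iff₀ hs]
        exact (ENNReal.ofReal_lt_ofReal_iff_of_nonneg hb.le).1 hr'
    _ = _ := by
        rw [lintegral_indicator measurableSet_Ioi, lintegral_Ioi_div_rpow hk (by positivity),
          ENNReal.ofReal_mul hk0.le, ← ENNReal.ofReal_rpow_of_pos (by positivity), one_div_div,
          ENNReal.ofReal_div_of_pos hb, ENNReal.ofReal_toReal hat]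

/-- The condition on `A` near infinity makes the inner integral defining `A_{n-1}` converge. -/
lemma shiftedTail_youngConj_lt_top {k : ℕ} (hk : 1 ≤ k) {A : ℝ → ℝ≥0∞} (hA : IsYoung A)
    (hT : TailCondition (k + 2) A) {lam : ℝ} (hlam : 0 < lam) :
    shiftedTail (k + 2) (youngConj A) lam < ⊤ := by
  obtain ⟨t₀, ht₀, hint⟩ := hT
  have hexp : (((k + 2 : ℕ) : ℝ) - 2) = k := by push_cast; ring
  rw [hexp] at hint
  let w : ℝ → ℝ≥0∞ := fun r => ENNReal.ofReal r / ENNReal.ofReal (r ^ (1 + youngExp (k + 2)))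
  have hw : Measurable w := by fun_prop
  let S : Set (ℝ × ℝ) := {q | A (max q.2 0) < ENNReal.ofReal (q.1 * q.2)}
  have hS : MeasurableSet S :=
    measurableSet_lt (hA.monotone_max.measurable.comp measurable_snd) (by fun_prop)
  let Φ : ℝ → ℝ → ℝ≥0∞ := fun r s => S.indicator (fun q => w q.1) (r, s)
  have hΦ : Measurable (Function.uncurry Φ) := (hw.comp measurable_fst).indicator hS
  refine ENNReal.mul_lt_top ENNReal.ofReal_lt_top ?_
  calc ∫⁻ r in Ioi lam, youngConj A r / ENNReal.ofReal (r ^ (1 + youngExp (k + 2)))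
      ≤ ∫⁻ r in Ioi lam, ∫⁻ s in Ioi 0, Φ r s := by
        refine setLIntegral_mono' measurableSet_Ioi fun r hr => ?_
        have hms : MeasurableSet {s | A (max s 0) < ENNReal.ofReal (r * s)} :=
          measurable_prodMk_left hS
        have h1 : ∀ s, Φ r s = {s | A (max s 0) < ENNReal.ofReal (r * s)}.indicator
            (fun _ => w r) s := fun _ => rfl
        simp_rw [h1]
        rw [lintegral_indicator_const hms]
        refine (ENNReal.div_le_div_right (youngConj_le_mul_volume hA (hlam.trans hr)) _).trans_eq ?_
        simp only [w, div_eq_mul_inv]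
        ring
    _ = ∫⁻ s in Ioi 0, ∫⁻ r in Ioi lam, Φ r s := lintegral_lintegral_swap hΦ.aemeasurable
    _ ≤ (∫⁻ s in Ioc 0 t₀, ∫⁻ r in Ioi lam, Φ r s) + ∫⁻ s in Ioi t₀, ∫⁻ r in Ioi lam, Φ r s := by
        rw [← Ioc_union_Ioi_eq_Ioi ht₀.le]
        exact lintegral_union_le _ _ _
    _ ≤ (∫⁻ s in Ioc 0 t₀, ENNReal.ofReal (k * (1 / lam) ^ (1 / (k : ℝ)))) +
        ∫⁻ s in Ioi t₀, ENNReal.ofReal k * (ENNReal.ofReal s / A s) ^ (1 / (k : ℝ)) := by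
        refine add_le_add (lintegral_mono fun s => ?_)
          (setLIntegral_mono' measurableSet_Ioi fun s hs => ?_)
        · rw [← lintegral_Ioi_div_rpow hk hlam]
          exact lintegral_mono fun r => indicator_le_self _ _ _
        · have hs0 : 0 < s := ht₀.trans hs
          refine le_trans (lintegral_mono fun r => ?_)
            (lintegral_indicator_lt_le hk (A s) hs0 lam)
          simp only [Φ, S]
          rw [indicator_apply, indicator_apply]
          simp [max_eq_left hs0.le, w]
    _ < ⊤ := by
        rw [setLIntegral_const, lintegral_const_mul' _ _ ENNReal.ofReal_ne_top]
        refine ENNReal.add_lt_top.2 ⟨?_, ENNReal.mul_lt_top ENNReal.ofReal_lt_top hint⟩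
        rw [Real.volume_Ioc]
        exact ENNReal.mul_lt_top ENNReal.ofReal_lt_top ENNReal.ofReal_lt_top

end Tail

section MeasurableGradient

variable {n : ℕ} {Ω : Set (Euc n)} {u : Euc n → ℝ} {g : Euc n → Euc n}

lemma integrable_mul_of_hasCompactSupport (hu : LocallyIntegrableOn u Ω volume)
    {ψ : Euc n → ℝ} (hψ : Continuous ψ) (hc : HasCompactSupport ψ) (hs : tsupport ψ ⊆ Ω) :
    Integrable fun x => u x * ψ x := by
  have h1 : IntegrableOn u (tsupport ψ) volume := hu.integrableOn_compact_subset hs hc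
  have h2 : IntegrableOn (fun x => u x * ψ x) (tsupport ψ) volume :=
    h1.mul_continuousOn hψ.continuousOn hc
  rwa [integrableOn_iff_integrable_of_support_subset] at h2
  intro x hx
  exact subset_tsupport ψ (right_ne_zero_of_mul hx)

lemma locallyIntegrableOn_of_integrable_mul {f : Euc n → ℝ} (hΩ : IsOpen Ω)
    (h : ∀ φ : Euc n → ℝ, ContDiff ℝ (⊤ : ℕ∞) φ → HasCompactSupport φ → tsupport φ ⊆ Ω →
      Integrable fun x => f x * φ x) : LocallyIntegrableOn f Ω volume := by
  intro x hx
  obtain ⟨ε, hε, hball⟩ := Metric.isOpen_iff.1 hΩ x hx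
  let b : ContDiffBump x := ⟨ε / 4, ε / 2, by positivity, by linarith⟩
  have hb := h b b.contDiff b.hasCompactSupport (by
    rw [b.tsupport_eq]
    exact (closedBall_subset_ball (by show ε / 2 < ε; linarith)).trans hball)
  refine ⟨ball x (ε / 4), mem_nhdsWithin_of_mem_nhds (ball_mem_nhds x (by positivity)), ?_⟩
  refine (hb.integrableOn (s := ball x (ε / 4))).congr_fun (fun y hy => ?_) measurableSet_ball
  simp only
  rw [b.one_of_mem_closedBall (ball_subset_closedBall hy), mul_one]

lemma integral_mul_fderiv_eq_zero (h : IsWeakGradOn Ω u g) {i : Fin n}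
    {φ : Euc n → ℝ} (hφ : ContDiff ℝ (⊤ : ℕ∞) φ) (hφc : HasCompactSupport φ)
    (hφΩ : tsupport φ ⊆ Ω) (hni : ¬ Integrable fun x => g x i * φ x)
    {ψ : Euc n → ℝ} (hψ : ContDiff ℝ (⊤ : ℕ∞) ψ) (hψc : HasCompactSupport ψ)
    (hψΩ : tsupport ψ ⊆ Ω) :
    ∫ x, u x * fderiv ℝ ψ x (EuclideanSpace.single i 1) = 0 := by
  by_cases hint : Integrable fun x => g x i * ψ x
  · have hI : ∀ {χ : Euc n → ℝ}, ContDiff ℝ (⊤ : ℕ∞) χ → HasCompactSupport χ → tsupport χ ⊆ Ω →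
        Integrable fun x => u x * fderiv ℝ χ x (EuclideanSpace.single i 1) := by
      intro χ hχ hχc hχΩ
      refine integrable_mul_of_hasCompactSupport h.1
        ((hχ.continuous_fderiv (by simp)).clm_apply continuous_const)
        (hχc.fderiv_apply ℝ _) ?_
      exact (tsupport_fderiv_apply_subset ℝ _).trans hχΩ
    have hsum : ¬ Integrable fun x => g x i * (φ + ψ) x := fun hs => by
      refine hni ((hs.sub hint).congr (Eventually.of_forall fun x => ?_))
      simp [mul_add]
    have h1 := h.2.2 φ hφ hφc hφΩ i
    have h2 := h.2.2 (φ + ψ) (hφ.add hψ) (hφc.add hψc)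
      ((tsupport_add φ ψ).trans (union_subset hφΩ hψΩ)) i
    rw [integral_undef hni, neg_zero] at h1
    rw [integral_undef hsum, neg_zero] at h2
    have h3 : ∀ x, u x * fderiv ℝ (φ + ψ) x (EuclideanSpace.single i 1) =
        u x * fderiv ℝ φ x (EuclideanSpace.single i 1) +
          u x * fderiv ℝ ψ x (EuclideanSpace.single i 1) := fun x => by
      rw [fderiv_add (hφ.differentiable (by simp) x) (hψ.differentiable (by simp) x)]
      simp [mul_add]
    simp_rw [h3] at h2
    rw [integral_add (hI hφ hφc hφΩ) (hI hψ hψc hψΩ), h1, zero_add] at h2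
    exact h2
  · rw [h.2.2 ψ hψ hψc hψΩ i, integral_undef hint, neg_zero]

/-- A weak gradient can be replaced by a locally integrable one without increasing its norm. -/
lemma IsWeakGradOn.exists_locallyIntegrableOn (hΩ : IsOpen Ω) (h : IsWeakGradOn Ω u g) :
    ∃ g' : Euc n → Euc n, IsWeakGradOn Ω u g' ∧ (∀ x, ‖g' x‖ ≤ ‖g x‖) ∧
      ∀ K ⊆ Ω, IsCompact K → IntegrableOn g' K volume := by
  classical
  let good : Fin n → Prop := fun i => ∀ φ : Euc n → ℝ, ContDiff ℝ (⊤ : ℕ∞) φ →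
    HasCompactSupport φ → tsupport φ ⊆ Ω → Integrable fun x => g x i * φ x
  let g' : Euc n → Euc n := fun x => WithLp.toLp 2 fun i => if good i then g x i else 0
  have hcoord : ∀ x i, g' x i = if good i then g x i else 0 := fun _ _ => rfl
  have hK : ∀ K ⊆ Ω, IsCompact K → IntegrableOn g' K volume := by
    intro K hKΩ hKc
    have hi : ∀ i, IntegrableOn (fun x => g' x i) K volume := fun i => by
      by_cases hg : good i
      · simp only [hcoord, if_pos hg]
        exact (locallyIntegrableOn_of_integrable_mul hΩ hg).integrableOn_compact_subset hKΩ hKc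
      · simp only [hcoord, if_neg hg]
        exact integrableOn_zero
    have hdec : g' = fun x => ∑ i, g' x i • EuclideanSpace.single i (1 : ℝ) := by
      funext x
      ext j
      simp [Finset.sum_apply, Pi.single_apply]
    rw [hdec]
    exact integrable_finsetSum _ fun i _ => (hi i).smul_const _
  refine ⟨g', ⟨h.1, ?_, ?_⟩, ?_, hK⟩
  · rw [locallyIntegrableOn_iff hΩ.isLocallyClosed]
    exact fun K hKΩ hKc => (hK K hKΩ hKc).norm
  · intro ψ hψ hψc hψΩ i
    by_cases hg : good i
    · simp only [hcoord, if_pos hg]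
      exact h.2.2 ψ hψ hψc hψΩ i
    · simp only [hcoord, if_neg hg, zero_mul, integral_zero, neg_zero]
      simp only [good] at hg
      push Not at hg
      obtain ⟨φ, hφ, hφc, hφΩ, hni⟩ := hg
      exact integral_mul_fderiv_eq_zero h hφ hφc hφΩ hni hψ hψc hψΩ
  · intro x
    rw [EuclideanSpace.norm_eq, EuclideanSpace.norm_eq]
    refine Real.sqrt_le_sqrt (Finset.sum_le_sum fun i _ => ?_)
    rw [hcoord]
    split_ifs
    · exact le_rfl
    · simpa using sq_nonneg _

end MeasurableGradient

section Chaining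

variable {n : ℕ} {u : Euc n → ℝ}

lemma abs_sub_le_of_chain {E : Type*} [NormedAddCommGroup E] [NormedSpace ℝ E] {u : E → ℝ}
    {B S : Set E} (hB : Convex ℝ B) (hSB : S ⊆ B)
    (hdense : ∀ z ∈ B, ∀ ε > 0, ∃ y ∈ S, dist y z < ε) {δ D : ℝ} (hδ : 0 < δ)
    (hloc : ∀ p ∈ S, ∀ q ∈ S, dist p q < 2 * δ → |u p - u q| ≤ D) (N : ℕ) :
    ∀ p ∈ S, ∀ q ∈ S, dist p q < (N + 1) * δ → |u p - u q| ≤ (N + 1) * D := by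
  induction N with
  | zero =>
    intro p hp q hq h
    have := hloc p hp q hq (by norm_num at h; linarith)
    simpa using this
  | succ N ih =>
    intro p hp q hq h
    push_cast at h ⊢
    have hN : (0 : ℝ) < N + 1 + 1 := by positivity
    set l : ℝ := (N + 1) / (N + 1 + 1) with hl
    have hl0 : 0 ≤ l := by positivity
    have hl1 : l ≤ 1 := (div_le_one hN).2 (by linarith)
    have hz : AffineMap.lineMap p q l ∈ B :=
      hB.lineMap_mem (hSB hp) (hSB hq) ⟨hl0, hl1⟩
    set z : E := AffineMap.lineMap p q l
    have h1 : dist p z < (N + 1) * δ := by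
      rw [dist_left_lineMap, Real.norm_of_nonneg hl0, hl, div_mul_eq_mul_div, div_lt_iff₀ hN]
      nlinarith
    have h2 : dist z q < δ := by
      rw [dist_lineMap_right, Real.norm_of_nonneg (by linarith), hl, one_sub_div hN.ne',
        add_sub_cancel_left, div_mul_eq_mul_div, div_lt_iff₀ hN]
      linarith
    obtain ⟨y, hy, hyz⟩ := hdense z hz (min δ ((N + 1) * δ - dist p z))
      (lt_min hδ (by linarith))
    have h3 := hyz.trans_le (min_le_left _ _)
    have h4 := hyz.trans_le (min_le_right _ _)
    have h5 := ih p hp y hy (by linarith [dist_triangle p z y, dist_comm z y])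
    have h6 := hloc y hy q hq (by linarith [dist_triangle y z q])
    calc |u p - u q| ≤ |u p - u y| + |u y - u q| := abs_sub_le _ _ _
      _ ≤ _ := by linarith

lemma exists_mem_dist_lt_of_ae {B S : Set (Euc n)} (hB : IsOpen B)
    (hS : ∀ᵐ y ∂volume.restrict B, y ∈ S) {z : Euc n} (hz : z ∈ B) {ε : ℝ} (hε : 0 < ε) :
    ∃ y ∈ S, dist y z < ε := by
  by_contra! hcon
  have hpos : 0 < volume (ball z ε ∩ B) :=
    (isOpen_ball.inter hB).measure_pos _ ⟨z, mem_ball_self hε, hz⟩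
  refine hpos.ne' (measure_mono_null (fun y hy => ?_) ((ae_restrict_iff' hB.measurableSet).1 hS))
  intro h
  exact absurd hy.1 (not_lt.2 (hcon y (h hy.2)))

lemma essOsc_ball_le {x : Euc n} {r ρ D : ℝ} (hρ : 0 < ρ) {N : ℕ}
    (hN : 2 * r ≤ (N + 1) * (ρ / 4))
    (h : ∀ c ∈ ball x r, ∃ m M : ℝ, M - m ≤ D ∧
      ∀ᵐ y ∂volume.restrict (ball c ρ), m ≤ u y ∧ u y ≤ M) :
    essOsc (ball x r) u ≤ ENNReal.ofReal ((N + 1) * D) := by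
  choose! m M hD hae using h
  let d : ℕ → Euc n := TopologicalSpace.denseSeq (Euc n)
  let S : Set (Euc n) := {y | y ∈ ball x r ∧ ∀ i, d i ∈ ball x r → y ∈ ball (d i) ρ →
    m (d i) ≤ u y ∧ u y ≤ M (d i)}
  have hS : ∀ᵐ y ∂volume.restrict (ball x r), y ∈ S := by
    have h1 : ∀ᵐ y ∂(volume : Measure (Euc n)), ∀ i, d i ∈ ball x r → y ∈ ball (d i) ρ →
        m (d i) ≤ u y ∧ u y ≤ M (d i) := by
      rw [ae_all_iff]
      intro i
      by_cases hi : d i ∈ ball x r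
      · filter_upwards [(ae_restrict_iff' measurableSet_ball).1 (hae _ hi)] with y hy _ using hy
      · exact Eventually.of_forall fun y h => absurd h hi
    filter_upwards [ae_restrict_of_ae h1, ae_restrict_mem measurableSet_ball] with y hy hyb
      using ⟨hyb, hy⟩
  have hloc : ∀ p ∈ S, ∀ q ∈ S, dist p q < 2 * (ρ / 4) → |u p - u q| ≤ D := by
    intro p hp q hq hpq
    obtain ⟨i, hi⟩ := (TopologicalSpace.denseRange_denseSeq (Euc n)).exists_mem_open
      (isOpen_ball.inter isOpen_ball) ⟨p, mem_ball_self (by positivity : 0 < ρ / 4), hp.1⟩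
    have hpi : dist (d i) p < ρ / 4 := hi.1
    have h1 := hp.2 i hi.2 (by rw [mem_ball, dist_comm]; linarith)
    have h2 := hq.2 i hi.2 (by
      rw [mem_ball]
      linarith [dist_triangle q p (d i), dist_comm q p, dist_comm p (d i)])
    have h3 := hD _ hi.2
    rw [abs_le]
    constructor <;> linarith [h1.1, h1.2, h2.1, h2.2]
  have hall := abs_sub_le_of_chain (convex_ball x r) (fun y (hy : y ∈ S) => hy.1)
    (fun z hz ε hε => exists_mem_dist_lt_of_ae isOpen_ball hS hz hε)
    (by positivity : 0 < ρ / 4) hloc N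
  refine essSup_le_of_ae_le _ ?_
  filter_upwards [Measure.quasiMeasurePreserving_fst.ae hS,
    Measure.quasiMeasurePreserving_snd.ae hS] with p hp hq
  refine ENNReal.ofReal_le_ofReal (hall _ hp _ hq (lt_of_lt_of_le ?_ hN))
  have h1 : dist p.1 x < r := hp.1
  have h2 : dist p.2 x < r := hq.1
  linarith [dist_triangle_right p.1 p.2 x]

end Chaining

section Main

lemma IsYoung.aemeasurable_comp {α : Type*} [MeasurableSpace α] {μ : Measure α} {A : ℝ → ℝ≥0∞}
    (hA : IsYoung A) {f : α → ℝ} (hf : AEMeasurable f μ) (hf0 : ∀ z, 0 ≤ f z) :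
    AEMeasurable (fun z => A (f z)) μ := by
  refine (hA.monotone_max.measurable.comp_aemeasurable hf).congr (Eventually.of_forall fun z => ?_)
  simp [max_eq_left (hf0 z)]

lemma IsWeakGradOn.aemeasurable_norm {n : ℕ} {Ω : Set (Euc n)} {u : Euc n → ℝ} {g : Euc n → Euc n}
    (h : IsWeakGradOn Ω u g) {K : Set (Euc n)} (hK : IsCompact K) (hKΩ : K ⊆ Ω) :
    AEMeasurable (fun z => ‖g z‖) (volume.restrict K) :=
  (h.2.1.integrableOn_compact_subset hKΩ hK).aestronglyMeasurable.aemeasurable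

variable {k : ℕ} {Ω : Set (Euc (k + 2))} {u : Euc (k + 2) → ℝ} {g : Euc (k + 2) → Euc (k + 2)}

lemma exists_abs_le_cube (hug : IsWeakGradOn Ω u g) (hmono : WeaklyMonotone Ω u)
    {c : Euc (k + 2)} {R : ℝ} (hR : 0 < R) (hW : closedCube c (2 * R) ⊆ Ω)
    (hg : IntegrableOn g (closedCube c (2 * R))) {F : Euc (k + 2) → ℝ≥0∞} (hF : Measurable F)
    (hFi : ∫⁻ z in closedCube c (2 * R), F z < ⊤) {G : ℝ → ℝ≥0∞}
    (hFG : ∀ᵐ z ∂volume.restrict (closedCube c (2 * R)), ∀ t, 0 ≤ t →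
      ENNReal.ofReal (t * ‖g z‖) ≤ F z + G t) (hG : kernelMean k G 1 < ⊤) :
    ∃ C : ℝ, ∀ᵐ x ∂volume.restrict (cube c (R / 2)), |u x| ≤ C := by
  set L : ℝ≥0∞ := ENNReal.ofReal (4 * R * ((k + 2 : ℕ) : ℝ)) * (2 * ((k + 2 : ℕ) : ℝ≥0∞) *
    (∫⁻ z in closedCube c (2 * R), F z) / ENNReal.ofReal (R / 2) +
      ENNReal.ofReal ((2 * R) ^ (k + 1)) * kernelMean k G 1) with hL
  have hLt : L ≠ ⊤ := by
    refine ENNReal.mul_ne_top ENNReal.ofReal_ne_top (ENNReal.add_ne_top.2 ⟨?_, ?_⟩)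
    · refine ENNReal.div_ne_top (ENNReal.mul_ne_top (by finiteness) hFi.ne) ?_
      simpa using hR
    · exact ENNReal.mul_ne_top ENNReal.ofReal_ne_top hG.ne
  have hP : 0 < (2 * R) ^ (k + 1) := by positivity
  have hω : 0 < (L.toReal + 1) / (2 * R) ^ (k + 1) := by
    have := ENNReal.toReal_nonneg (a := L)
    positivity
  obtain ⟨m, M, -, h⟩ := exists_bounds_cube hug hmono hR hW hg hF hFG one_pos hω (by
    rw [← hL, one_mul, mul_div_cancel₀ _ hP.ne']
    nth_rewrite 1 [← ENNReal.ofReal_toReal hLt]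
    exact (ENNReal.ofReal_lt_ofReal_iff (by positivity)).2 (lt_add_one _))
  refine ⟨max |m| |M|, ?_⟩
  filter_upwards [h] with x hx using abs_le_max_abs_abs hx.1 hx.2

lemma closedCube_subset_ball {n : ℕ} {x c : Euc n} {r ρ : ℝ} (hρ : 0 ≤ ρ)
    (h : dist c x + n * ρ < r) : closedCube c ρ ⊆ ball x r :=
  (closedCube_subset_closedBall c hρ).trans
    (closedBall_subset_ball' (by linarith))

lemma locBounded_of_weaklyMonotone (hΩ : IsOpen Ω) {A : ℝ → ℝ≥0∞} (hA : IsYoung A)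
    (hT : 1 ≤ k → TailCondition (k + 2) A) (h : MemW1Aloc A Ω u g) (hmono : WeaklyMonotone Ω u)
    {x : Euc (k + 2)} (hx : x ∈ Ω) :
    ∃ r > (0 : ℝ), ∃ C : ℝ, ∀ᵐ y ∂volume.restrict (ball x r), |u y| ≤ C := by
  obtain ⟨ε, hε, hball⟩ := Metric.isOpen_iff.1 hΩ x hx
  obtain ⟨g', hg', hle, hint⟩ := h.1.exists_locallyIntegrableOn hΩ
  have hn : (0 : ℝ) < ((k + 2 : ℕ) : ℝ) := by positivity
  set ρ : ℝ := ε / 2 with hρ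
  have hρ0 : 0 < ρ := by positivity
  have hρΩ : closedBall x ρ ⊆ Ω := (closedBall_subset_ball (by linarith)).trans hball
  set R : ℝ := ρ / (4 * ((k + 2 : ℕ) : ℝ)) with hRdef
  have hR : 0 < R := by positivity
  have hRn : ((k + 2 : ℕ) : ℝ) * (2 * R) = ρ / 2 := by rw [hRdef]; field_simp; norm_num
  have hcube : closedCube x (2 * R) ⊆ ball x ρ :=
    closedCube_subset_ball (by positivity) (by rw [dist_self, hRn]; linarith)
  have hcubeΩ := (hcube.trans ball_subset_closedBall).trans hρΩ
  have hgi := hint _ hcubeΩ (isCompact_closedCube x (2 * R))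
  have hm := h.1.aemeasurable_norm (isCompact_closedCube x (2 * R)) hcubeΩ
  suffices ∃ C : ℝ, ∀ᵐ y ∂volume.restrict (cube x (R / 2)), |u y| ≤ C by
    obtain ⟨C, hC⟩ := this
    exact ⟨R / 2, by positivity, C, ae_restrict_of_ae_restrict_of_subset (ball_subset_cube x _) hC⟩
  rcases Nat.eq_zero_or_pos k with rfl | hk
  · have hne : AEMeasurable (fun z => ‖g' z‖ₑ) (volume.restrict (closedCube x (2 * R))) :=
      hgi.aestronglyMeasurable.enorm
    refine exists_abs_le_cube hg' hmono hR hcubeΩ hgi hne.measurable_mk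
      (G := fun t => if t ≤ 1 then 0 else ⊤) ?_ ?_ (by simp [kernelMean_zero])
    · rw [← lintegral_congr_ae hne.ae_eq_mk]
      exact hgi.hasFiniteIntegral
    · filter_upwards [hne.ae_eq_mk] with z hz t ht
      rw [← hz]
      split_ifs with h1
      · rw [add_zero, ← ofReal_norm]
        exact ENNReal.ofReal_le_ofReal (mul_le_of_le_one_left (norm_nonneg _) h1)
      · simp
  · obtain ⟨-, lam, hlam, hfin⟩ := h.2 (ball x ρ) isOpen_ball
      ((isCompact_closedBall x ρ).of_isClosed_subset isClosed_closure
        closure_ball_subset_closedBall)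
      (closure_ball_subset_closedBall.trans hρΩ)
    simp only [abs_norm] at hfin
    have hne : AEMeasurable (fun z => A (‖g z‖ / lam)) (volume.restrict (closedCube x (2 * R))) :=
      hA.aemeasurable_comp (hm.div_const lam) fun z => by positivity
    refine exists_abs_le_cube hg' hmono hR hcubeΩ hgi hne.measurable_mk
      (G := fun t => youngConj A (lam * t)) ?_ ?_ ?_
    · rw [← lintegral_congr_ae hne.ae_eq_mk]
      exact (lintegral_mono_set hcube).trans_lt hfin
    · filter_upwards [hne.ae_eq_mk] with z hz t ht
      rw [← hz]
      refine le_trans (ENNReal.ofReal_le_ofReal ?_)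
        (ofReal_mul_le_add_youngConj A (by positivity) _)
      calc t * ‖g' z‖ ≤ t * ‖g z‖ := by gcongr; exact hle z
        _ = ‖g z‖ / lam * (lam * t) := by field_simp
    · have hk1 : kernelMean k (fun t => youngConj A (lam * t)) 1 =
          kernelMean k (youngConj A) lam := by simp [kernelMean]
      rw [hk1]
      exact (kernelMean_le_shiftedTail hk (monotone_youngConj A) hlam).trans_lt
        (ENNReal.mul_lt_top ENNReal.ofReal_lt_top (shiftedTail_youngConj_lt_top hk hA (hT hk) hlam))

lemma essOsc_le_of_lt_youngShifted (k : ℕ) :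
    ∃ c : ℝ, 0 < c ∧ ∀ {Ω : Set (Euc (k + 2))} {u : Euc (k + 2) → ℝ}
      {g : Euc (k + 2) → Euc (k + 2)} {A : ℝ → ℝ≥0∞}, IsOpen Ω → IsYoung A →
      IsWeakGradOn Ω u g → WeaklyMonotone Ω u → ∀ {x : Euc (k + 2)} {r : ℝ}, 0 < r →
      closedBall x (2 * r) ⊆ Ω → ∀ {s : ℝ}, 0 < s →
      (∫⁻ z in ball x (2 * r), A ‖g z‖) / volume (ball x (2 * r)) < youngShifted (k + 2) A s →
      essOsc (ball x r) u ≤ ENNReal.ofReal (c * r) * ENNReal.ofReal s := by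
  set n : ℝ := ((k + 2 : ℕ) : ℝ) with hn
  have hn0 : 0 < n := by positivity
  set v : ℝ := (volume (ball (0 : Euc (k + 2)) 1)).toReal with hv
  have hv0 : 0 ≤ v := ENNReal.toReal_nonneg
  set V : ℝ := v * (8 * n) ^ (k + 2) / 2 ^ (k + 1) with hVdef
  have hV0 : 0 ≤ V := by positivity
  set K : ℝ := 3 + 2 ^ (2 * k + 1) * 4 ^ (k + 1) with hK
  have hK0 : 0 < K := by positivity
  set B : ℝ := 4 * n * (4 * n * V + 1) * K + 1 with hB
  have hB0 : 0 < B := by positivity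
  refine ⟨128 * B, by positivity, ?_⟩
  intro Ω u g A hΩ hA hug hmono x r hr hball s hs hτ
  set τ : ℝ≥0∞ := (∫⁻ z in ball x (2 * r), A ‖g z‖) / volume (ball x (2 * r)) with hτdef
  obtain ⟨t, ht, hscale⟩ := exists_scale k hA hs hτ
  obtain ⟨g', hg', hle, hint⟩ := hug.exists_locallyIntegrableOn hΩ
  set R : ℝ := r / (4 * n) with hRdef
  have hR : 0 < R := by positivity
  have hrR : r = 4 * n * R := by rw [hRdef]; field_simp
  have hvol : volume (ball x (2 * r)) = ENNReal.ofReal (V * R * (2 * R) ^ (k + 1)) := by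
    rw [Measure.addHaar_ball _ _ (by positivity), ← ENNReal.ofReal_toReal
      (measure_ball_lt_top (μ := volume) (x := (0 : Euc (k + 2))) (r := 1)).ne,
      ← ENNReal.ofReal_mul (by positivity), ← hv, finrank_euclideanSpace_fin, hVdef, hrR]
    congr 1
    rw [mul_pow 2 R]
    field_simp
    ring_nf
  have hJ : ∫⁻ z in ball x (2 * r), A ‖g z‖ = τ * ENNReal.ofReal (V * R * (2 * R) ^ (k + 1)) := by
    rw [hτdef, ← hvol, ENNReal.div_mul_cancel
      (measure_ball_pos _ _ (by positivity)).ne' measure_ball_lt_top.ne]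
  have hm : AEMeasurable (fun z => A ‖g z‖) (volume.restrict (ball x (2 * r))) :=
    hA.aemeasurable_comp ((hug.aemeasurable_norm (isCompact_closedBall _ _) hball).mono_measure
      (Measure.restrict_mono ball_subset_closedBall le_rfl)) fun z => norm_nonneg _
  have hP : 0 < (2 * R) ^ (k + 1) := by positivity
  have key : ∀ c ∈ ball x r, ∃ m M : ℝ, M - m ≤ 8 * (B * R * s) ∧
      ∀ᵐ y ∂volume.restrict (ball c (R / 2)), m ≤ u y ∧ u y ≤ M := by
    intro c hc
    have hcube : closedCube c (2 * R) ⊆ ball x (2 * r) := by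
      refine closedCube_subset_ball (by positivity) ?_
      have hc' : dist c x < r := hc
      rw [← hn]
      nlinarith
    have hcubeΩ := (hcube.trans ball_subset_closedBall).trans hball
    have hFae : ∀ᵐ z ∂volume.restrict (closedCube c (2 * R)), A ‖g z‖ = hm.mk _ z :=
      ae_restrict_of_ae_restrict_of_subset hcube hm.ae_eq_mk
    obtain ⟨m, M, hmM, hae⟩ := exists_bounds_cube hg' hmono hR hcubeΩ
      (hint _ hcubeΩ (isCompact_closedCube c _)) hm.measurable_mk (G := youngConj A) (t := t)
      (ω := B * R * s) (by
        filter_upwards [hFae] with z hz t ht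
        rw [← hz]
        refine le_trans (ENNReal.ofReal_le_ofReal ?_)
          (ofReal_mul_le_add_youngConj A (norm_nonneg _) _)
        rw [mul_comm]
        gcongr
        exact hle z) ht (by positivity) (by
        have hJc : ∫⁻ z in closedCube c (2 * R), hm.mk _ z ≤
            τ * ENNReal.ofReal (V * R * (2 * R) ^ (k + 1)) := by
          rw [← hJ, ← lintegral_congr_ae hFae]
          exact lintegral_mono_set hcube
        have h2n : 2 * ((k + 2 : ℕ) : ℝ≥0∞) = ENNReal.ofReal (2 * n) := by
          rw [ENNReal.ofReal_mul zero_le_two, hn, ENNReal.ofReal_natCast, ENNReal.ofReal_ofNat]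
        rw [h2n, ← hn]
        calc _ ≤ ENNReal.ofReal (4 * R * n) * (ENNReal.ofReal (2 * n) *
              (τ * ENNReal.ofReal (V * R * (2 * R) ^ (k + 1))) / ENNReal.ofReal (R / 2) +
              ENNReal.ofReal ((2 * R) ^ (k + 1)) * kernelMean k (youngConj A) t) := by gcongr
          _ = ENNReal.ofReal (4 * R * n) * (ENNReal.ofReal (4 * n * V * (2 * R) ^ (k + 1)) * τ +
              ENNReal.ofReal ((2 * R) ^ (k + 1)) * kernelMean k (youngConj A) t) := by
            congr 2
            rw [mul_left_comm, ← ENNReal.ofReal_mul (by positivity), mul_div_assoc,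
              ← ENNReal.ofReal_div_of_pos (by positivity), mul_comm]
            congr 2
            field_simp
            ring
          _ ≤ ENNReal.ofReal (4 * R * n) *
              (ENNReal.ofReal ((4 * n * V + 1) * (2 * R) ^ (k + 1)) * τ +
              ENNReal.ofReal ((4 * n * V + 1) * (2 * R) ^ (k + 1)) *
                kernelMean k (youngConj A) t) := by
            gcongr
            · linarith
            · exact le_mul_of_one_le_left hP.le (by nlinarith [mul_nonneg hn0.le hV0])
          _ ≤ ENNReal.ofReal (4 * R * n) * (ENNReal.ofReal ((4 * n * V + 1) * (2 * R) ^ (k + 1)) *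
              ENNReal.ofReal (K * (s * t))) := by
            rw [← mul_add]
            gcongr
          _ = ENNReal.ofReal
              ((4 * n * (4 * n * V + 1) * K) * (t * (2 * R) ^ (k + 1) * (R * s))) := by
            rw [← ENNReal.ofReal_mul (by positivity), ← ENNReal.ofReal_mul (by positivity)]
            congr 1
            ring
          _ < _ := by
            refine (ENNReal.ofReal_lt_ofReal_iff (by positivity)).2 ?_
            have : 0 < t * (2 * R) ^ (k + 1) * (R * s) := by positivity
            rw [hB]
            nlinarith)
    exact ⟨m, M, hmM, ae_restrict_of_ae_restrict_of_subset (ball_subset_cube c _) hae⟩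
  have hcast : ((64 * (k + 2) - 1 : ℕ) : ℝ) + 1 = 64 * n := by
    rw [hn, ← Nat.cast_add_one, Nat.sub_add_cancel (by omega)]
    push_cast; ring
  refine (essOsc_ball_le (by positivity) (N := 64 * (k + 2) - 1) ?_ key).trans_eq ?_
  · rw [hcast, hrR]; linarith
  · rw [← ENNReal.ofReal_mul (by positivity), hcast, hrR]
    congr 1
    ring

end Main

theorem weaklyMonotone_locBounded_essOsc {n : ℕ} (hn : 2 ≤ n) :
    ∃ c : ℝ, 0 < c ∧
      ∀ (Ω : Set (Euc n)), IsOpen Ω →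
        ∀ A : ℝ → ℝ≥0∞, IsYoung A → (3 ≤ n → TailCondition n A) →
          ∀ (u : Euc n → ℝ) (g : Euc n → Euc n), MemW1Aloc A Ω u g →
            WeaklyMonotone Ω u →
            (∀ x ∈ Ω, ∃ r > (0 : ℝ), ∃ Cb : ℝ,
                ∀ᵐ y ∂volume.restrict (ball x r), |u y| ≤ Cb) ∧
            ∀ (x : Euc n) (r : ℝ), 0 < r → closedBall x (2 * r) ⊆ Ω →
              essOsc (ball x r) u ≤
                ENNReal.ofReal (c * r) *
                  youngInv (youngShifted n A)
                    ((∫⁻ z in ball x (2 * r), A ‖g z‖) / volume (ball x (2 * r))) := by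
  obtain ⟨k, rfl⟩ := Nat.exists_eq_add_of_le' hn
  obtain ⟨c, hc, hosc⟩ := essOsc_le_of_lt_youngShifted k
  refine ⟨c, hc, fun Ω hΩ A hA hT u g h hmono => ⟨fun x hx => ?_, fun x r hr hball => ?_⟩⟩
  · exact locBounded_of_weaklyMonotone hΩ hA (fun hk => hT (by omega)) h hmono hx
  · have hcr : ENNReal.ofReal (c * r) ≠ 0 := by
      simp only [ne_eq, ENNReal.ofReal_eq_zero, not_le]; positivity
    rw [mul_comm, ← ENNReal.div_le_iff hcr ENNReal.ofReal_ne_top]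
    refine le_iInf₂ fun s hs => ?_
    rw [ENNReal.div_le_iff hcr ENNReal.ofReal_ne_top, mul_comm]
    have hs0 : 0 < s := by
      refine lt_of_le_of_ne hs.1 fun h0 => ?_
      rw [← h0, youngShifted_zero hA] at hs
      exact ENNReal.not_lt_zero hs.2
    exact hosc hΩ hA h.1 hmono hr hball hs0 hs.2
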